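/- There exist constants c ≥ 10⁻⁴, δ > 0 and n₀ ∈ ℕ such that the following holds: for every finite abelian group G of even order n ≥ n₀ in which the number of elements x ∈ G with x + x = 0 is at most δ·n, the number of maximal sum-free subsets of G satisfies f_max(G) ≤ 2^{(1/2 − c)·μ(G)}. -/

import Mathlib

/-- A subset `A` of an additive group is *sum-free* if there are no
`x, y, z ∈ A` (not necessarily distinct) with `x + y = z`. -/
def IsSumFree {G : Type*} [AddCommGroup G] (A : Set G) : Prop :=
  ∀ x ∈ A, ∀ y ∈ A, x + y ∉ A

/-- `A` is a maximal sum-free subset of `G`. -/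
def IsMaximalSumFree {G : Type*} [AddCommGroup G] (A : Set G) : Prop :=
  IsSumFree A ∧ ∀ B : Set G, IsSumFree B → A ⊆ B → A = B

/-- `μ(G)`: the maximum size of a sum-free subset of `G`. -/
noncomputable def sumFreeMu (G : Type*) [AddCommGroup G] [Fintype G] : ℕ :=
  sSup {k : ℕ | ∃ A : Set G, IsSumFree A ∧ A.ncard = k}

/-- `f_max(G)`: the number of maximal sum-free subsets of `G`. -/
noncomputable def fMaxSF (G : Type*) [AddCommGroup G] [Fintype G] : ℕ :=
  Nat.card {A : Set G // IsMaximalSumFree A}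

section MaximalSumFree

open Finset

open scoped Classical in
/-- The maximal independent sets of the subgraph of `Γ` induced on `U`. -/
noncomputable def misFamily {V : Type*} (Γ : SimpleGraph V) (U : Finset V) :
    Finset (Finset V) :=
  {I ∈ U.powerset | (∀ x ∈ I, ∀ y ∈ I, ¬ Γ.Adj x y) ∧ ∀ x ∈ U, x ∉ I → ∃ y ∈ I, Γ.Adj x y}

open scoped Classical in
/-- The vertices of `U` outside the closed neighbourhood of `u`. -/
noncomputable def outsideNbhd {V : Type*} (Γ : SimpleGraph V) (U : Finset V) (u : V) : Finset V :=
  {x ∈ U | x ≠ u ∧ ¬ Γ.Adj u x}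

open scoped Classical in
/-- The neighbours of `u` inside `U`. -/
noncomputable def nbhdIn {V : Type*} (Γ : SimpleGraph V) (U : Finset V) (u : V) : Finset V :=
  {x ∈ U | Γ.Adj u x}

section Mis

variable {V : Type*} {Γ : SimpleGraph V} {U : Finset V}

lemma mem_misFamily {I : Finset V} : I ∈ misFamily Γ U ↔ I ⊆ U ∧
    (∀ x ∈ I, ∀ y ∈ I, ¬ Γ.Adj x y) ∧ ∀ x ∈ U, x ∉ I → ∃ y ∈ I, Γ.Adj x y := by
  simp [misFamily]

lemma mem_outsideNbhd {u x : V} : x ∈ outsideNbhd Γ U u ↔ x ∈ U ∧ x ≠ u ∧ ¬ Γ.Adj u x := by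
  simp [outsideNbhd]

lemma mem_nbhdIn {u x : V} : x ∈ nbhdIn Γ U u ↔ x ∈ U ∧ Γ.Adj u x := by
  simp [nbhdIn]

lemma outsideNbhd_subset (u : V) : outsideNbhd Γ U u ⊆ U := fun _ hx ↦ (mem_outsideNbhd.1 hx).1

lemma card_outsideNbhd {u : V} (hu : u ∈ U) :
    #(outsideNbhd Γ U u) + #(nbhdIn Γ U u) + 1 = #U := by
  classical
  have h1 : U = insert u (outsideNbhd Γ U u ∪ nbhdIn Γ U u) := by
    ext x; simp only [mem_insert, mem_union, mem_outsideNbhd, mem_nbhdIn]; grind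
  have hd : Disjoint (outsideNbhd Γ U u) (nbhdIn Γ U u) := by
    rw [disjoint_left]; intro x; simp only [mem_outsideNbhd, mem_nbhdIn]; tauto
  conv_rhs => rw [h1]
  rw [card_insert_of_notMem, card_union_of_disjoint hd]
  simp [mem_outsideNbhd, mem_nbhdIn]

lemma card_misFamily_filter_mem_le [DecidableEq V] (u : V) :
    #{I ∈ misFamily Γ U | u ∈ I} ≤ #(misFamily Γ (outsideNbhd Γ U u)) := by
  refine card_le_card_of_injOn (fun I ↦ I.erase u) ?_ ?_
  · intro I hI
    simp only [coe_filter, Set.mem_ofPred_eq, mem_misFamily, mem_coe] at hI ⊢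
    obtain ⟨⟨hU, hi, hm⟩, hu⟩ := hI
    refine ⟨fun x hx ↦ ?_, fun x hx y hy ↦ hi x (mem_of_mem_erase hx) y (mem_of_mem_erase hy), ?_⟩
    · rw [mem_erase] at hx
      exact mem_outsideNbhd.2 ⟨hU hx.2, hx.1, hi u hu x hx.2⟩
    · intro x hx hxI
      rw [mem_outsideNbhd] at hx
      obtain ⟨y, hy, hxy⟩ := hm x hx.1 (fun h ↦ hxI (mem_erase.2 ⟨hx.2.1, h⟩))
      refine ⟨y, mem_erase.2 ⟨?_, hy⟩, hxy⟩
      rintro rfl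
      exact hx.2.2 hxy.symm
  · intro I hI J hJ h
    simp only [coe_filter, Set.mem_ofPred_eq] at hI hJ
    rw [← insert_erase hI.2, ← insert_erase hJ.2]
    exact congrArg _ h

lemma card_misFamily_le_sum (T : Finset V) (hT : ∀ I ∈ misFamily Γ U, ∃ u ∈ T, u ∈ I) :
    #(misFamily Γ U) ≤ ∑ u ∈ T, #(misFamily Γ (outsideNbhd Γ U u)) := by
  classical
  calc #(misFamily Γ U) ≤ #(T.biUnion fun u ↦ {I ∈ misFamily Γ U | u ∈ I}) := by
        refine card_le_card fun I hI ↦ ?_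
        obtain ⟨u, hu, huI⟩ := hT I hI
        exact mem_biUnion.2 ⟨u, hu, mem_filter.2 ⟨hI, huI⟩⟩
    _ ≤ ∑ u ∈ T, #{I ∈ misFamily Γ U | u ∈ I} := card_biUnion_le
    _ ≤ _ := sum_le_sum fun u _ ↦ card_misFamily_filter_mem_le u

lemma card_misFamily_le_sum_nbhdIn [DecidableEq V] {w : V} (hw : w ∈ U) :
    #(misFamily Γ U) ≤
      ∑ u ∈ insert w (nbhdIn Γ U w), #(misFamily Γ (outsideNbhd Γ U u)) := by
  refine card_misFamily_le_sum _ fun I hI ↦ ?_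
  obtain ⟨hU, -, hm⟩ := mem_misFamily.1 hI
  by_cases h : w ∈ I
  · exact ⟨w, by simp, h⟩
  · obtain ⟨y, hy, hwy⟩ := hm w hw h
    exact ⟨y, mem_insert_of_mem (mem_nbhdIn.2 ⟨hU hy, hwy⟩), hy⟩

lemma card_misFamily_le_add [DecidableEq V] (v : V) :
    #(misFamily Γ U) ≤ #(misFamily Γ (U.erase v)) + #(misFamily Γ (outsideNbhd Γ U v)) := by
  rw [← card_filter_add_card_filter_not (s := misFamily Γ U) (fun I ↦ v ∈ I), add_comm]
  refine Nat.add_le_add (card_le_card fun I hI ↦ ?_) (card_misFamily_filter_mem_le v)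
  obtain ⟨hI, hv⟩ := mem_filter.1 hI
  obtain ⟨hU, hi, hm⟩ := mem_misFamily.1 hI
  exact mem_misFamily.2 ⟨fun x hx ↦ mem_erase.2 ⟨fun h ↦ hv (h ▸ hx), hU hx⟩, hi,
    fun x hx ↦ hm x (mem_of_mem_erase hx)⟩

lemma card_misFamily_empty : #(misFamily Γ ∅) ≤ 1 := by
  calc #(misFamily Γ ∅) ≤ #({∅} : Finset (Finset V)) :=
        card_le_card fun I hI ↦ by simpa using (mem_misFamily.1 hI).1
    _ = 1 := rfl

/-- The Moon–Moser bound. -/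
lemma card_misFamily_le_pow {r : ℝ} (hr : 0 ≤ r) (hr3 : r ^ 3 = 3) (U : Finset V) :
    (#(misFamily Γ U) : ℝ) ≤ r ^ #U := by
  classical
  have hr1 : 1 ≤ r := by
    by_contra! h
    have := pow_lt_one₀ hr h (n := 3) (by norm_num)
    linarith
  have key (k : ℕ) : (k + 1 : ℝ) ≤ r ^ (k + 1) := by
    refine le_of_pow_le_pow_left₀ (n := 3) (by norm_num) (by positivity) ?_
    rw [← pow_mul, mul_comm, pow_mul, hr3]
    have : (k + 1) ^ 3 ≤ 3 ^ (k + 1) := by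
      induction k with
      | zero => norm_num
      | succ k ih =>
        rcases k with _ | _ | k
        · norm_num
        · norm_num
        · have h : (k + 1 + 1 + 1 + 1) ^ 3 ≤ 3 * (k + 1 + 1 + 1) ^ 3 := by
            nlinarith [Nat.zero_le (k ^ 3), Nat.zero_le (k ^ 2)]
          rw [pow_succ 3]
          linarith
    exact_mod_cast this
  induction U using Finset.strongInduction with
  | H U ih =>
  rcases U.eq_empty_or_nonempty with rfl | hne
  · simpa using card_misFamily_empty (Γ := Γ)
  obtain ⟨w, hw, hmin⟩ := exists_min_image U (fun v ↦ #(nbhdIn Γ U v)) hne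
  set k := #(nbhdIn Γ U w) with hk
  have hkU : k + 1 ≤ #U := by have := card_outsideNbhd (Γ := Γ) hw; omega
  calc (#(misFamily Γ U) : ℝ)
      ≤ ∑ u ∈ insert w (nbhdIn Γ U w), (#(misFamily Γ (outsideNbhd Γ U u)) : ℝ) := by
        exact_mod_cast card_misFamily_le_sum_nbhdIn hw
    _ ≤ ∑ u ∈ insert w (nbhdIn Γ U w), r ^ (#U - (k + 1)) := by
        refine sum_le_sum fun u hu ↦ ?_
        have huU : u ∈ U := by
          rcases mem_insert.1 hu with rfl | hu
          exacts [hw, (mem_nbhdIn.1 hu).1]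
        refine (ih _ ⟨outsideNbhd_subset u, fun h ↦ ?_⟩).trans
          (pow_le_pow_right₀ hr1 ?_)
        · exact (mem_outsideNbhd.1 (h huU)).2.1 rfl
        · have := card_outsideNbhd (Γ := Γ) huU
          have := hmin u huU
          omega
    _ = (k + 1) * r ^ (#U - (k + 1)) := by
        rw [sum_const, card_insert_of_notMem (by simp [mem_nbhdIn]), nsmul_eq_mul]
        push_cast; rfl
    _ ≤ r ^ (k + 1) * r ^ (#U - (k + 1)) := by gcongr; exact key k
    _ = r ^ #U := by rw [← pow_add]; congr 1; omega

lemma outsideNbhd_ssubset {u : V} (hu : u ∈ U) : outsideNbhd Γ U u ⊂ U :=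
  ⟨outsideNbhd_subset u, fun h ↦ (mem_outsideNbhd.1 (h hu)).2.1 rfl⟩

/-- The Hujter–Tuza bound for triangle-free graphs. -/
lemma card_misFamily_le_pow_of_triangleFree {r : ℝ} (hr : 0 ≤ r) (hr2 : r ^ 2 = 2) (U : Finset V)
    (hU : ∀ x ∈ U, ∀ y ∈ U, ∀ z ∈ U, Γ.Adj x y → Γ.Adj y z → ¬ Γ.Adj x z) :
    (#(misFamily Γ U) : ℝ) ≤ r ^ #U := by
  classical
  have hr1 : 1 ≤ r := by nlinarith
  have hr14 : r ≤ 1.415 := by nlinarith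
  have hr14' : 1.414 ≤ r := by nlinarith
  have hr3 : r ^ 3 = 2 * r := by rw [pow_succ, hr2]
  have hr4 : r ^ 4 = 4 := by rw [show 4 = 2 * 2 by rfl, pow_mul, hr2]; norm_num
  induction U using Finset.strongInduction with
  | H U ih =>
  have ih' (W : Finset V) (hW : W ⊂ U) (k : ℕ) (hk : #W + k ≤ #U) :
      (#(misFamily Γ W) : ℝ) ≤ r ^ (#U - k) :=
    (ih W hW fun x hx y hy z hz ↦ hU x (hW.1 hx) y (hW.1 hy) z (hW.1 hz)).trans
      (pow_le_pow_right₀ hr1 (by omega))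
  rcases U.eq_empty_or_nonempty with rfl | hne
  · simpa using card_misFamily_empty (Γ := Γ)
  by_cases h1 : ∃ w ∈ U, #(nbhdIn Γ U w) ≤ 1
  · obtain ⟨w, hw, hw1⟩ := h1
    have hb : (#(misFamily Γ U) : ℝ)
      ≤ ∑ u ∈ insert w (nbhdIn Γ U w), (#(misFamily Γ (outsideNbhd Γ U u)) : ℝ) := by
        exact_mod_cast card_misFamily_le_sum_nbhdIn hw
    have hcw := card_outsideNbhd (Γ := Γ) hw
    rcases Nat.le_one_iff_eq_zero_or_eq_one.1 hw1 with h0 | h1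
    · rw [card_eq_zero.1 h0, insert_empty_eq, sum_singleton] at hb
      exact hb.trans ((ih' _ (outsideNbhd_ssubset (Γ := Γ) hw) 0 (by omega)).trans (by simp))
    · obtain ⟨u, hu⟩ := card_eq_one.1 h1
      have huw : u ∈ nbhdIn Γ U w := by simp [hu]
      rw [mem_nbhdIn] at huw
      have hcu := card_outsideNbhd (Γ := Γ) huw.1
      have hcu1 : 0 < #(nbhdIn Γ U u) := card_pos.2 ⟨w, mem_nbhdIn.2 ⟨hw, huw.2.symm⟩⟩
      rw [hu, sum_pair huw.2.ne] at hb
      have e1 := ih' _ (outsideNbhd_ssubset (Γ := Γ) hw) 2 (by omega)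
      have e2 := ih' _ (outsideNbhd_ssubset (Γ := Γ) huw.1) 2 (by omega)
      calc (#(misFamily Γ U) : ℝ) ≤ r ^ 2 * r ^ (#U - 2) := by rw [hr2]; linarith
        _ = r ^ #U := by rw [← pow_add]; congr 1; omega
  push Not at h1
  by_cases h3 : ∃ v ∈ U, 3 ≤ #(nbhdIn Γ U v)
  · obtain ⟨v, hv, hv3⟩ := h3
    have hc := card_outsideNbhd (Γ := Γ) hv
    have e1 := ih' _ (erase_ssubset hv) 1 (by rw [card_erase_of_mem hv]; omega)
    have e2 := ih' _ (outsideNbhd_ssubset (Γ := Γ) hv) 4 (by omega)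
    have hb : (#(misFamily Γ U) : ℝ) ≤ _ := Nat.cast_le.2 (card_misFamily_le_add (Γ := Γ) v)
    push_cast at hb
    have e3 : r ^ (#U - 1) = r ^ 3 * r ^ (#U - 4) := by rw [← pow_add]; congr 1; omega
    have e4 : r ^ #U = r ^ 4 * r ^ (#U - 4) := by rw [← pow_add]; congr 1; omega
    have e5 : 0 < r ^ (#U - 4) := by positivity
    rw [e4, hr4]
    rw [e3, hr3] at e1
    nlinarith
  push Not at h3
  have h2 (v : V) (hv : v ∈ U) : #(nbhdIn Γ U v) = 2 := by
    have := h1 v hv; have := h3 v hv; omega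
  obtain ⟨v, hv⟩ := hne
  obtain ⟨a, b, hab, hvab⟩ := card_eq_two.1 (h2 v hv)
  have hva : a ∈ U ∧ Γ.Adj v a := mem_nbhdIn.1 (by simp [hvab])
  have hvb : b ∈ U ∧ Γ.Adj v b := mem_nbhdIn.1 (by simp [hvab])
  have hcv := card_outsideNbhd (Γ := Γ) hv
  have hca : #((nbhdIn Γ U a).erase v) = 1 := by
    rw [card_erase_of_mem (mem_nbhdIn.2 ⟨hv, hva.2.symm⟩), h2 a hva.1]
  obtain ⟨c, hc⟩ := card_eq_one.1 hca
  have hac : c ≠ v ∧ c ∈ U ∧ Γ.Adj a c := by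
    have : c ∈ (nbhdIn Γ U a).erase v := by simp [hc]
    simpa [mem_nbhdIn] using this
  have hvc : ¬ Γ.Adj v c := hU v hv a hva.1 c hac.2.1 hva.2 hac.2.2
  set W := U.erase v with hW
  have hWU : W ⊂ U := erase_ssubset hv
  have hcW : #W + 1 = #U := card_erase_add_one hv
  have haW : a ∈ W := mem_erase.2 ⟨hva.2.ne', hva.1⟩
  have hcW' : c ∈ W := mem_erase.2 ⟨hac.1, hac.2.1⟩
  have hNa : nbhdIn Γ W a = {c} := by
    rw [← hc]; ext x; simp [mem_nbhdIn, hW]; tauto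
  have hNc : nbhdIn Γ W c = nbhdIn Γ U c := by
    ext x; simp only [mem_nbhdIn, hW, mem_erase]
    refine ⟨fun h ↦ ⟨h.1.2, h.2⟩, fun h ↦ ⟨⟨?_, h.1⟩, h.2⟩⟩
    rintro rfl
    exact hvc h.2.symm
  have hca' := card_outsideNbhd (Γ := Γ) haW
  have hcc' := card_outsideNbhd (Γ := Γ) hcW'
  rw [hNa, card_singleton] at hca'
  rw [hNc, h2 c hac.2.1] at hcc'
  rw [h2 v hv] at hcv
  have hb : (#(misFamily Γ U) : ℝ) ≤ _ := Nat.cast_le.2 (card_misFamily_le_add (Γ := Γ) v)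
  have hb2 : (#(misFamily Γ W) : ℝ) ≤ _ :=
    Nat.cast_le.2 (card_misFamily_le_sum_nbhdIn (Γ := Γ) haW)
  rw [hNa, sum_pair hac.2.2.ne] at hb2
  push_cast at hb hb2
  have e1 := ih' _ (outsideNbhd_ssubset (Γ := Γ) hv) 3 (by omega)
  have e2 := ih' _ ((outsideNbhd_ssubset (Γ := Γ) haW).trans hWU) 3 (by omega)
  have e3 := ih' _ ((outsideNbhd_ssubset (Γ := Γ) hcW').trans hWU) 4 (by omega)
  have e4 : r ^ (#U - 3) = r * r ^ (#U - 4) := by rw [← pow_succ']; congr 1; omega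
  have e5 : r ^ #U = r ^ 4 * r ^ (#U - 4) := by rw [← pow_add]; congr 1; omega
  have e6 : 0 < r ^ (#U - 4) := by positivity
  rw [e5, hr4]
  rw [e4] at e1 e2
  nlinarith

/-- The number of ordered adjacent pairs of `Γ` inside `U`. -/
noncomputable def adjPairs (Γ : SimpleGraph V) (U : Finset V) : ℕ := ∑ v ∈ U, #(nbhdIn Γ U v)

lemma adjPairs_le_add [DecidableEq V] {d : ℕ} (hd : ∀ v ∈ U, #(nbhdIn Γ U v) ≤ d)
    {W : Finset V} (hW : W ⊆ U) : adjPairs Γ U ≤ adjPairs Γ W + 2 * d * #(U \ W) := by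
  unfold adjPairs
  have h1 : ∑ v ∈ U, #(nbhdIn Γ U v) = ∑ v ∈ U \ W, #(nbhdIn Γ U v) + ∑ v ∈ W, #(nbhdIn Γ U v) :=
    (sum_sdiff hW).symm
  have h2 : ∑ v ∈ U \ W, #(nbhdIn Γ U v) ≤ #(U \ W) * d :=
    sum_le_card_nsmul _ _ _ fun v hv ↦ hd v (mem_sdiff.1 hv).1
  have h3 : ∑ v ∈ W, #(nbhdIn Γ U v)
      ≤ ∑ v ∈ W, (#(nbhdIn Γ W v) + #(nbhdIn Γ (U \ W) v)) := by
    refine sum_le_sum fun v _ ↦ (card_le_card fun x hx ↦ ?_).trans (card_union_le _ _)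
    simp only [mem_union, mem_nbhdIn, mem_sdiff] at hx ⊢
    tauto
  have h4 : ∑ v ∈ W, #(nbhdIn Γ (U \ W) v) ≤ #(U \ W) * d := by
    have : ∑ v ∈ W, #(nbhdIn Γ (U \ W) v) = ∑ v ∈ U \ W, #(nbhdIn Γ W v) := by
      classical
      unfold nbhdIn
      have := sum_card_bipartiteAbove_eq_sum_card_bipartiteBelow (s := W) (t := U \ W) Γ.Adj
      simp only [bipartiteAbove, bipartiteBelow] at this
      convert! this using 4
      exact Γ.adj_comm _ _
    rw [this]
    refine sum_le_card_nsmul _ _ _ fun v hv ↦ (card_le_card fun x hx ↦ ?_).trans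
      (hd v (mem_sdiff.1 hv).1)
    rw [mem_nbhdIn] at hx ⊢
    exact ⟨hW hx.1, hx.2⟩
  rw [sum_add_distrib] at h3
  nlinarith

/-- A branching bound: if `Γ'` is a subgraph of `Γ` of maximum degree at most `d`, and maximal
independent sets of induced subgraphs of `Γ` are bounded by `2 ^ (l * size)`, then this bound
improves in the presence of many edges of `Γ'`. -/
lemma card_misFamily_le_of_branching {Γ' : SimpleGraph V} (hΓ : Γ' ≤ Γ) {d k : ℕ} (hd0 : 0 < d)
    {a b l : ℝ} (hb : 0 ≤ b) (hbr : (2 : ℝ) ^ (-(a - b)) + 2 ^ (-((k + 2) * (a - b))) ≤ 1)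
    (hab : b ≤ a) (hl : l ≤ a - b * k / (2 * d))
    (hd : ∀ v ∈ U, #(nbhdIn Γ' U v) ≤ d)
    (hleaf : ∀ W ⊆ U, (#(misFamily Γ W) : ℝ) ≤ 2 ^ (l * #W)) :
    (#(misFamily Γ U) : ℝ) ≤ 2 ^ (a * #U - b / (2 * d) * adjPairs Γ' U) := by
  classical
  induction U using Finset.strongInduction with
  | H U ih =>
  have hd' : (0 : ℝ) < d := by exact_mod_cast hd0
  have ih' (W : Finset V) (hW : W ⊂ U) (j : ℝ) (hj : #W + j ≤ #U) :
      (#(misFamily Γ W) : ℝ) ≤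
        2 ^ (-(j * (a - b))) * 2 ^ (a * #U - b / (2 * d) * adjPairs Γ' U) := by
    have hdW : ∀ v ∈ W, #(nbhdIn Γ' W v) ≤ d := fun v hv ↦
      (card_le_card fun x hx ↦ mem_nbhdIn.2 ⟨hW.1 (mem_nbhdIn.1 hx).1, (mem_nbhdIn.1 hx).2⟩).trans
        (hd v (hW.1 hv))
    refine (ih W hW hdW fun X hX ↦ hleaf X (hX.trans hW.1)).trans ?_
    rw [← Real.rpow_add (by norm_num)]
    refine Real.rpow_le_rpow_of_exponent_le (by norm_num) ?_
    have h1 : (adjPairs Γ' U : ℝ) ≤ adjPairs Γ' W + 2 * d * (#U - #W) := by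
      have := adjPairs_le_add hd hW.1
      have h2 := card_sdiff_add_card_eq_card hW.1
      have h3 : (#(U \ W) : ℝ) = #U - #W := by rw [← h2]; push_cast; ring
      rw [← h3]; exact_mod_cast this
    have h4 : b / (2 * d) * adjPairs Γ' U ≤
        b / (2 * d) * adjPairs Γ' W + b * (#U - #W) := by
      calc _ ≤ b / (2 * d) * (adjPairs Γ' W + 2 * d * (#U - #W)) := by gcongr
        _ = _ := by field_simp
    nlinarith
  by_cases h : ∃ v ∈ U, k + 1 ≤ #(nbhdIn Γ' U v)
  · obtain ⟨v, hv, hvk⟩ := h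
    have hvk' : k + 1 ≤ #(nbhdIn Γ U v) := hvk.trans (card_le_card fun x hx ↦
      mem_nbhdIn.2 ⟨(mem_nbhdIn.1 hx).1, hΓ (mem_nbhdIn.1 hx).2⟩)
    have hc := card_outsideNbhd (Γ := Γ) hv
    have e1 := ih' _ (erase_ssubset hv) 1 (by exact_mod_cast (card_erase_add_one hv).le)
    have e2 := ih' _ (outsideNbhd_ssubset (Γ := Γ) hv) (k + 2) (by norm_cast; omega)
    have hb : (#(misFamily Γ U) : ℝ) ≤ _ := Nat.cast_le.2 (card_misFamily_le_add (Γ := Γ) v)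
    push_cast at hb
    rw [one_mul] at e1
    have : (0 : ℝ) < 2 ^ (a * #U - b / (2 * d) * adjPairs Γ' U) := by positivity
    nlinarith
  · push Not at h
    refine (hleaf U subset_rfl).trans (Real.rpow_le_rpow_of_exponent_le (by norm_num) ?_)
    have h1 : (adjPairs Γ' U : ℝ) ≤ k * #U := by
      have : adjPairs Γ' U ≤ #U * k := sum_le_card_nsmul _ _ _ fun v hv ↦ by
        have := h v hv; omega
      rw [mul_comm]; exact_mod_cast this
    calc l * #U ≤ (a - b * k / (2 * d)) * #U := by gcongr
      _ = a * #U - b / (2 * d) * (k * #U) := by ring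
      _ ≤ _ := by gcongr

/-- Vertices of an exceptional set `D` cost at most a factor `2` each. -/
lemma card_misFamily_le_two_pow_mul [DecidableEq V] {D : Finset V} {P : Finset V → Prop} {K : ℝ}
    (hP : ∀ W, P W → ∀ v ∈ W, v ∈ D → P (W.erase v) ∧ P (outsideNbhd Γ W v))
    (hK : ∀ W, P W → Disjoint W D → (#(misFamily Γ W) : ℝ) ≤ K) (hK0 : 0 ≤ K) (hU : P U) :
    (#(misFamily Γ U) : ℝ) ≤ 2 ^ #D * K := by
  suffices h : (#(misFamily Γ U) : ℝ) ≤ 2 ^ #(U ∩ D) * K by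
    refine h.trans ?_
    gcongr
    · norm_num
    · exact inter_subset_right
  induction U using Finset.strongInduction with
  | H U ih =>
  by_cases h : Disjoint U D
  · rw [disjoint_iff_inter_eq_empty.1 h]
    simpa using hK U hU h
  · obtain ⟨v, hv, hvD⟩ := not_disjoint_iff.1 h
    obtain ⟨h1, h2⟩ := hP U hU v hv hvD
    have hlt (W : Finset V) (hW : W ⊆ U) (hvW : v ∉ W) : #(W ∩ D) + 1 ≤ #(U ∩ D) := by
      refine card_lt_card ⟨inter_subset_inter_right hW, fun h ↦ ?_⟩
      exact hvW (mem_inter.1 (h (mem_inter.2 ⟨hv, hvD⟩))).1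
    have l1 := hlt _ (erase_subset v U) (notMem_erase v U)
    have l2 := hlt _ (outsideNbhd_subset (Γ := Γ) v) (by simp [mem_outsideNbhd])
    have e1 := ih _ (erase_ssubset hv) h1
    have e2 := ih _ (outsideNbhd_ssubset (Γ := Γ) hv) h2
    have hb : (#(misFamily Γ U) : ℝ) ≤ _ := Nat.cast_le.2 (card_misFamily_le_add (Γ := Γ) v)
    push_cast at hb
    obtain ⟨m, hm⟩ : ∃ m, #(U ∩ D) = m + 1 := ⟨#(U ∩ D) - 1, by omega⟩
    rw [hm] at l1 l2 ⊢
    have p1 : (2 : ℝ) ^ #(U.erase v ∩ D) * K ≤ 2 ^ m * K := by gcongr; norm_num; omega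
    have p2 : (2 : ℝ) ^ #(outsideNbhd Γ U v ∩ D) * K ≤ 2 ^ m * K := by gcongr; norm_num; omega
    rw [pow_succ]
    linarith

end Mis

section SmallSets

/-- There are few subsets of small relative size. -/
lemma exists_card_small_subsets_le {ξ : ℝ} (hξ : 0 < ξ) : ∃ ρ : ℝ, 0 < ρ ∧
    ∀ (V : Type) [Fintype V] [DecidableEq V],
      (#{F : Finset V | (#F : ℝ) ≤ ρ * Fintype.card V} : ℝ) ≤ 2 ^ (ξ * Fintype.card V) := by
  have h1 : (1 : ℝ) < 2 ^ (ξ / 2) := Real.one_lt_rpow (by norm_num) (by positivity)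
  obtain ⟨k, hk⟩ := exists_pow_lt_of_lt_one (sub_pos.2 h1) (by norm_num : (1 / 2 : ℝ) < 1)
  have hk' : (1 / 2 : ℝ) ^ (k + 1) ≤ 2 ^ (ξ / 2) - 1 :=
    (pow_le_pow_of_le_one (by norm_num) (by norm_num) (Nat.le_succ k)).trans hk.le
  refine ⟨ξ / (2 * (k + 1)), by positivity, fun V _ _ ↦ ?_⟩
  set n := Fintype.card V
  set x : ℝ := (1 / 2) ^ (k + 1) with hx
  have hx0 : 0 < x := by positivity
  set S : Finset (Finset V) := {F : Finset V | (#F : ℝ) ≤ ξ / (2 * (k + 1)) * n}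
  have hsum : ∑ F : Finset V, x ^ #F = (1 + x) ^ n := by
    have := Fintype.sum_pow_mul_eq_add_pow V x 1
    simpa [add_comm] using this
  have hlow (F : Finset V) (hF : F ∈ S) : (2 : ℝ) ^ (-(ξ / 2 * n)) ≤ x ^ #F := by
    have hF' : (#F : ℝ) ≤ ξ / (2 * (k + 1)) * n := (mem_filter.1 hF).2
    have : x ^ #F = (2 : ℝ) ^ (-((k + 1) * #F : ℝ)) := by
      rw [hx, ← pow_mul, one_div, inv_pow, Real.rpow_neg (by norm_num)]
      norm_cast
    rw [this]
    refine Real.rpow_le_rpow_of_exponent_le (by norm_num) (neg_le_neg ?_)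
    calc (k + 1 : ℝ) * #F ≤ (k + 1) * (ξ / (2 * (k + 1)) * n) := by gcongr
      _ = ξ / 2 * n := by field_simp
  have h2 : (#S : ℝ) * 2 ^ (-(ξ / 2 * n)) ≤ 2 ^ (ξ / 2 * n) := by
    calc (#S : ℝ) * 2 ^ (-(ξ / 2 * n)) = ∑ F ∈ S, (2 : ℝ) ^ (-(ξ / 2 * n)) := by simp
      _ ≤ ∑ F ∈ S, x ^ #F := sum_le_sum hlow
      _ ≤ ∑ F : Finset V, x ^ #F :=
        sum_le_sum_of_subset_of_nonneg (subset_univ _) fun _ _ _ ↦ by positivity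
      _ = (1 + x) ^ n := hsum
      _ ≤ ((2 : ℝ) ^ (ξ / 2)) ^ n := by gcongr; linarith
      _ = _ := by rw [← Real.rpow_natCast, ← Real.rpow_mul (by norm_num)]
  rw [Real.rpow_neg (by norm_num), ← div_eq_mul_inv, div_le_iff₀ (by positivity),
    ← Real.rpow_add (by norm_num)] at h2
  convert! h2 using 2
  ring

end SmallSets

section Containers

variable {G : Type} [AddCommGroup G] [Fintype G]

open scoped Classical in
/-- The pairs `(x, y)` with `x`, `y` and `x + y` all in `A`. -/
noncomputable def schurPairs (A : Finset G) : Finset (G × G) := {p ∈ A ×ˢ A | p.1 + p.2 ∈ A}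

omit [Fintype G] in
lemma mem_schurPairs {A : Finset G} {p : G × G} :
    p ∈ schurPairs A ↔ p.1 ∈ A ∧ p.2 ∈ A ∧ p.1 + p.2 ∈ A := by
  simp [schurPairs, and_assoc]

omit [AddCommGroup G] [Fintype G] in
/-- A fingerprint of an independent set `I` of a graph on `C`, outside whose neighbourhood all
vertices of `I` have small degree. -/
lemma exists_fingerprint (R : G → G → Prop) [DecidableRel R] (C I : Finset G)
    {q : ℕ} (hq : 0 < q) :
    ∃ F ⊆ I, #F * q ≤ #C ∧
      ∀ v ∈ I, #{y ∈ C | (¬ ∃ f ∈ F, R f y) ∧ R v y} < q := by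
  classical
  let P : Finset (Finset G) := {F ∈ I.powerset | #F * q ≤ #{y ∈ C | ∃ f ∈ F, R f y}}
  have hP : P.Nonempty := ⟨∅, by simp [P]⟩
  obtain ⟨F, hF, hmax⟩ := exists_max_image P card hP
  simp only [P, mem_filter, mem_powerset] at hF
  refine ⟨F, hF.1, hF.2.trans (card_le_card (filter_subset _ _)), fun v hv ↦ ?_⟩
  by_contra hcon
  rw [not_lt] at hcon
  have hvF : v ∉ F := by
    intro hvF
    obtain ⟨y, hy⟩ := card_pos.1 (hq.trans_le hcon)
    simp only [mem_filter] at hy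
    exact hy.2.1 ⟨v, hvF, hy.2.2⟩
  have h1 : insert v F ∈ P := by
    simp only [P, mem_filter, mem_powerset]
    refine ⟨insert_subset hv hF.1, ?_⟩
    rw [card_insert_of_notMem hvF]
    have hsub : {y ∈ C | ∃ f ∈ F, R f y} ∪ {y ∈ C | (¬ ∃ f ∈ F, R f y) ∧ R v y} ⊆
        {y ∈ C | ∃ f ∈ insert v F, R f y} := by
      intro y; simp only [mem_union, mem_filter, mem_insert]; grind
    have hd : Disjoint {y ∈ C | ∃ f ∈ F, R f y} {y ∈ C | (¬ ∃ f ∈ F, R f y) ∧ R v y} := by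
      rw [disjoint_left]; intro y hy hy'
      exact (mem_filter.1 hy').2.1 (mem_filter.1 hy).2
    have := card_le_card hsub
    rw [card_union_of_disjoint hd] at this
    have hF2 := hF.2
    rw [add_mul, one_mul]
    omega
  have := hmax _ h1
  rw [card_insert_of_notMem hvF] at this
  omega

open scoped Classical in
/-- The container obtained from `C` and the fingerprints `T`, `F`. -/
noncomputable def containerOf (η : ℝ) (K q : ℕ) (C T F : Finset G) : Finset G :=
  if #T < K then {v ∈ C | (#{x ∈ C | v + x ∈ C} : ℝ) < η / 2 * Fintype.card G ∨ v ∈ T}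
  else {v ∈ C | (¬ ∃ f ∈ F, v - f ∈ T ∨ f - v ∈ T) ∧
    #{y ∈ C | (¬ ∃ f ∈ F, y - f ∈ T ∨ f - y ∈ T) ∧ (y - v ∈ T ∨ v - y ∈ T)} < q}

open scoped Classical in
omit [Fintype G] in
lemma card_schurPairs (C : Finset G) :
    #(schurPairs C) = ∑ v ∈ C, #{x ∈ C | v + x ∈ C} := by
  rw [schurPairs, card_filter, sum_product]
  simp_rw [card_filter]

open scoped Classical in
lemma exists_container_step_aux {η : ℝ} (hη : 0 < η) {K q : ℕ} (hq : 0 < q) (hKq : 4 * q ≤ η * K)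
    (hn : 4 * K ≤ η * Fintype.card G) {C I : Finset G}
    (hC : η * Fintype.card G ^ 2 ≤ #(schurPairs C)) (hI : IsSumFree (I : Set G)) (hIC : I ⊆ C) :
    ∃ T F : Finset G, #T ≤ K ∧ #F * q ≤ Fintype.card G ∧ I ⊆ containerOf η K q C T F ∧
      containerOf η K q C T F ⊆ C ∧
      (#(containerOf η K q C T F) : ℝ) ≤ #C - η / 8 * Fintype.card G := by
  set n := Fintype.card G with hndef
  have hn0 : 0 < n := Fintype.card_pos
  have hn0' : (0 : ℝ) < n := by exact_mod_cast hn0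
  have hCn : #C ≤ n := card_le_univ C
  have hCn' : (#C : ℝ) ≤ n := by exact_mod_cast hCn
  set Hi : Finset G := {v ∈ C | ¬ (#{x ∈ C | v + x ∈ C} : ℝ) < η / 2 * n} with hHi
  have hcC (T F : Finset G) : containerOf η K q C T F ⊆ C := by
    unfold containerOf; split <;> exact filter_subset _ _
  have hmHi (v : G) : v ∈ Hi ↔ v ∈ C ∧ ¬ (#{x ∈ C | v + x ∈ C} : ℝ) < η / 2 * n := by
    rw [hHi, mem_filter]
  by_cases hcase : #(I ∩ Hi) < K
  · have hmem (v : G) : v ∈ containerOf η K q C (I ∩ Hi) ∅ ↔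
        v ∈ C ∧ ((#{x ∈ C | v + x ∈ C} : ℝ) < η / 2 * n ∨ v ∈ I ∩ Hi) := by
      simp only [containerOf, if_pos hcase, mem_filter, hndef]
    refine ⟨I ∩ Hi, ∅, hcase.le, by simp, ?_, hcC _ _, ?_⟩
    · intro v hv
      rw [hmem]
      refine ⟨hIC hv, ?_⟩
      by_cases h : (#{x ∈ C | v + x ∈ C} : ℝ) < η / 2 * n
      · exact .inl h
      · exact .inr (mem_inter.2 ⟨hv, (hmHi v).2 ⟨hIC hv, h⟩⟩)
    · have h1 : η / 2 * n ≤ #Hi := by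
        have : (#(schurPairs C) : ℝ) ≤ #Hi * n + n * (η / 2 * n) := by
          rw [card_schurPairs, ← sum_filter_not_add_sum_filter C
            (fun v ↦ (#{x ∈ C | v + x ∈ C} : ℝ) < η / 2 * n)]
          push_cast
          refine add_le_add ?_ ?_
          · rw [← nsmul_eq_mul]
            refine sum_le_card_nsmul _ _ _ fun v _ ↦ ?_
            exact_mod_cast (card_le_univ _)
          · calc _ ≤ (#{v ∈ C | (#{x ∈ C | v + x ∈ C} : ℝ) < η / 2 * n} : ℝ) * (η / 2 * n) := by
                  rw [← nsmul_eq_mul]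
                  exact sum_le_card_nsmul _ _ _ fun v hv ↦ (mem_filter.1 hv).2.le
              _ ≤ _ := by gcongr; exact card_le_univ _
        have h3 : η / 2 * n * n ≤ #Hi * n := by nlinarith
        exact le_of_mul_le_mul_right h3 hn0'
      have h2 : containerOf η K q C (I ∩ Hi) ∅ ⊆ (C \ Hi) ∪ (I ∩ Hi) := by
        intro v hv
        rw [hmem] at hv
        rw [mem_union, mem_sdiff, hmHi]
        exact hv.2.imp (fun h ↦ ⟨hv.1, fun h' ↦ h'.2 h⟩) id
      have h3 := (card_le_card h2).trans (card_union_le _ _)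
      have h4 : #(C \ Hi) + #Hi = #C := card_sdiff_add_card_eq_card (filter_subset _ _)
      have h5 : (#(containerOf η K q C (I ∩ Hi) ∅) : ℝ) + #Hi ≤ #C + K := by
        have h6 : #(containerOf η K q C (I ∩ Hi) ∅) + #Hi ≤ #C + K := by omega
        exact_mod_cast h6
      linarith
  · push Not at hcase
    obtain ⟨T, hT, hTK⟩ := exists_subset_card_eq hcase
    have hTI : T ⊆ I := hT.trans inter_subset_left
    have hTH : T ⊆ Hi := hT.trans inter_subset_right
    obtain ⟨F, hFI, hFq, hF⟩ := exists_fingerprint (fun v y : G ↦ y - v ∈ T ∨ v - y ∈ T) C I hq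
    have hmem (v : G) : v ∈ containerOf η K q C T F ↔ v ∈ C ∧
        (¬ ∃ f ∈ F, v - f ∈ T ∨ f - v ∈ T) ∧
        #{y ∈ C | (¬ ∃ f ∈ F, y - f ∈ T ∨ f - y ∈ T) ∧ (y - v ∈ T ∨ v - y ∈ T)} < q := by
      simp only [containerOf, hTK, lt_irrefl, if_false, mem_filter]
    refine ⟨T, F, hTK.le, hFq.trans hCn, ?_, hcC _ _, ?_⟩
    · intro v hv
      rw [hmem]
      refine ⟨hIC hv, ?_, hF v hv⟩
      rintro ⟨f, hf, h | h⟩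
      · exact hI _ (hTI h) f (hFI hf) (by simpa using hv)
      · exact hI _ (hTI h) v hv (by simpa using hFI hf)
    · set C' := containerOf η K q C T F
      set P : Finset (G × G) := {p ∈ C ×ˢ C | p.2 - p.1 ∈ T} with hP
      have hP1 : K * (η / 2 * n) ≤ (#P : ℝ) := by
        have hPT : ∑ t ∈ T, #{x ∈ C | t + x ∈ C} ≤ #P := by
          rw [← card_sigma]
          refine card_le_card_of_injOn (fun p ↦ (p.2, p.1 + p.2)) ?_ ?_
          · rintro ⟨t, x⟩ h
            simp only [coe_sigma, Set.mem_sigma_iff, mem_coe, mem_filter] at h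
            simp [hP, h]
          · rintro ⟨t, x⟩ - ⟨t', x'⟩ - h
            simp only [Prod.mk.injEq] at h
            obtain ⟨rfl, h⟩ := h
            simpa using h
        calc K * (η / 2 * n) = ∑ t ∈ T, (η / 2 * n) := by rw [sum_const, hTK, nsmul_eq_mul]
          _ ≤ ∑ t ∈ T, (#{x ∈ C | t + x ∈ C} : ℝ) :=
            sum_le_sum fun t ht ↦ not_lt.1 (mem_filter.1 (hTH ht)).2
          _ ≤ _ := by exact_mod_cast hPT
      have hsub : P ⊆ (C'.sigma fun v ↦ {y ∈ C | (¬ ∃ f ∈ F, y - f ∈ T ∨ f - y ∈ T) ∧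
          (y - v ∈ T ∨ v - y ∈ T)}).image (fun p ↦ (p.1, p.2)) ∪
          ((C \ C') ×ˢ T).image (fun p ↦ (p.1, p.1 + p.2)) ∪
          ((C \ C') ×ˢ T).image (fun p ↦ (p.1 - p.2, p.1)) := by
        rintro ⟨x, y⟩ h
        simp only [hP, mem_filter, mem_product] at h
        by_cases hx : x ∈ C'
        · by_cases hy : y ∈ C'
          · refine mem_union_left _ (mem_union_left _ (mem_image.2 ⟨⟨x, y⟩, ?_, rfl⟩))
            have := (hmem y).1 hy
            simp only [mem_sigma, mem_filter]
            exact ⟨hx, h.1.2, this.2.1, .inl h.2⟩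
          · refine mem_union_right _ (mem_image.2 ⟨(y, y - x), ?_, by simp⟩)
            simp [h, hy]
        · refine mem_union_left _ (mem_union_right _ (mem_image.2 ⟨(x, y - x), ?_, by simp⟩))
          simp [h, hx]
      have hP2 : #P ≤ n * q + #(C \ C') * K + #(C \ C') * K := by
        refine (card_le_card hsub).trans ((card_union_le _ _).trans (Nat.add_le_add
          ((card_union_le _ _).trans (Nat.add_le_add (card_image_le.trans ?_)
          (card_image_le.trans ?_))) (card_image_le.trans ?_)))
        · rw [card_sigma]
          refine (sum_le_card_nsmul C' _ q fun v hv ↦ ((hmem v).1 hv).2.2.le).trans ?_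
          rw [smul_eq_mul]
          exact Nat.mul_le_mul_right _ (card_le_univ _)
        · rw [card_product, hTK]
        · rw [card_product, hTK]
      have h4 : #(C \ C') + #C' = #C := card_sdiff_add_card_eq_card (hcC _ _)
      have h5 : (#(C \ C') : ℝ) + #C' = #C := by exact_mod_cast h4
      have hP2' : (#P : ℝ) ≤ n * q + #(C \ C') * K + #(C \ C') * K := by exact_mod_cast hP2
      have hK0 : (0 : ℝ) < K := by
        have : (0 : ℝ) < q := by exact_mod_cast hq
        by_contra! h
        nlinarith
      have h6 : η / 8 * n * K ≤ #(C \ C') * K := by nlinarith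
      have := le_of_mul_le_mul_right h6 hK0
      linarith

open scoped Classical in
lemma exists_container_step {η ξ : ℝ} (hη : 0 < η) (hξ : 0 < ξ) :
    ∃ n₀ : ℕ, ∀ (G : Type) [AddCommGroup G] [Fintype G], n₀ ≤ Fintype.card G →
      ∀ C : Finset G, η * Fintype.card G ^ 2 ≤ #(schurPairs C) →
      ∃ 𝓕 : Finset (Finset G), (#𝓕 : ℝ) ≤ 2 ^ (ξ * Fintype.card G) ∧
        (∀ D ∈ 𝓕, (#D : ℝ) ≤ #C - η / 8 * Fintype.card G) ∧
        ∀ I : Finset G, IsSumFree (I : Set G) → I ⊆ C → ∃ D ∈ 𝓕, I ⊆ D := by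
  obtain ⟨ρ, hρ, hsmall⟩ := exists_card_small_subsets_le (half_pos hξ)
  obtain ⟨q, hq⟩ := exists_nat_ge (1 / ρ)
  have hq0 : 0 < q := by
    have : (0 : ℝ) < q := lt_of_lt_of_le (by positivity) hq
    exact_mod_cast this
  obtain ⟨K, hK⟩ := exists_nat_ge (4 * q / η)
  obtain ⟨n₁, hn₁⟩ := exists_nat_ge (4 * K / η)
  obtain ⟨n₂, hn₂⟩ := exists_nat_ge (K / ρ)
  refine ⟨max n₁ n₂, fun G _ _ hn C hC ↦ ?_⟩
  set n := Fintype.card G with hndef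
  have hn1 : (n₁ : ℝ) ≤ n := by exact_mod_cast (le_max_left _ _).trans hn
  have hn2 : (n₂ : ℝ) ≤ n := by exact_mod_cast (le_max_right _ _).trans hn
  rw [div_le_iff₀ hη] at hK hn₁
  rw [div_le_iff₀ hρ] at hn₂ hq
  set S : Finset (Finset G) := {F : Finset G | (#F : ℝ) ≤ ρ * n} with hS
  refine ⟨{D ∈ (S ×ˢ S).image fun p ↦ containerOf η K q C p.1 p.2 |
    (#D : ℝ) ≤ #C - η / 8 * n}, ?_, fun D hD ↦ (mem_filter.1 hD).2, fun I hI hIC ↦ ?_⟩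
  · calc _ ≤ ((#S * #S : ℕ) : ℝ) := by
          rw [← card_product]
          exact_mod_cast (card_le_card (filter_subset _ _)).trans card_image_le
      _ ≤ 2 ^ (ξ / 2 * n) * 2 ^ (ξ / 2 * n) := by
          push_cast
          have := hsmall G
          gcongr
      _ = _ := by rw [← Real.rpow_add (by norm_num)]; congr 1; ring
  · obtain ⟨T, F, hT, hF, h1, h2, h3⟩ := exists_container_step_aux (K := K) (q := q) hη hq0
      (by linarith) (by rw [← hndef]; nlinarith) hC hI hIC
    refine ⟨containerOf η K q C T F, mem_filter.2 ⟨mem_image.2 ⟨(T, F), ?_, rfl⟩, h3⟩, h1⟩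
    simp only [hS, mem_product, mem_filter, mem_univ, true_and]
    constructor
    · have : (#T : ℝ) ≤ K := by exact_mod_cast hT
      nlinarith
    · have h4 : (#F : ℝ) * q ≤ n := by exact_mod_cast hF
      have : (0 : ℝ) ≤ #F := by positivity
      nlinarith

open scoped Classical in
/-- The container lemma for sum-free sets. -/
lemma exists_containers {η ξ : ℝ} (hη : 0 < η) (hξ : 0 < ξ) :
    ∃ n₀ : ℕ, ∀ (G : Type) [AddCommGroup G] [Fintype G], n₀ ≤ Fintype.card G →
      ∃ 𝓕 : Finset (Finset G), (#𝓕 : ℝ) ≤ 2 ^ (ξ * Fintype.card G) ∧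
        (∀ D ∈ 𝓕, (#(schurPairs D) : ℝ) < η * Fintype.card G ^ 2) ∧
        ∀ I : Finset G, IsSumFree (I : Set G) → ∃ D ∈ 𝓕, I ⊆ D := by
  obtain ⟨m, hm⟩ := exists_nat_gt (8 / η)
  have hm0 : (0 : ℝ) < m := lt_trans (by positivity) hm
  obtain ⟨n₀, hn₀⟩ := exists_container_step hη (div_pos hξ hm0)
  refine ⟨n₀, fun G _ _ hn ↦ ?_⟩
  set n := Fintype.card G with hndef
  have hn0' : (0 : ℝ) < n := by exact_mod_cast Fintype.card_pos (α := G)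
  have key (j : ℕ) : ∃ 𝓕 : Finset (Finset G), (#𝓕 : ℝ) ≤ (2 ^ (ξ / m * n)) ^ j ∧
      (∀ D ∈ 𝓕, (#(schurPairs D) : ℝ) < η * n ^ 2 ∨ (#D : ℝ) ≤ n - j * (η / 8 * n)) ∧
      ∀ I : Finset G, IsSumFree (I : Set G) → ∃ D ∈ 𝓕, I ⊆ D := by
    induction j with
    | zero =>
      refine ⟨{univ}, by simp, fun D _ ↦ .inr ?_, fun I _ ↦ ⟨univ, by simp, subset_univ I⟩⟩
      simpa using (by exact_mod_cast card_le_univ D : (#D : ℝ) ≤ n)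
    | succ j ih =>
      obtain ⟨𝓕, h1, h2, h3⟩ := ih
      have hstep (C : Finset G) : ∃ 𝓔 : Finset (Finset G), (#𝓔 : ℝ) ≤ 2 ^ (ξ / m * n) ∧
          (∀ D ∈ 𝓔, (#(schurPairs D) : ℝ) < η * n ^ 2 ∨ (#D : ℝ) ≤ #C - η / 8 * n) ∧
          ∀ I : Finset G, IsSumFree (I : Set G) → I ⊆ C → ∃ D ∈ 𝓔, I ⊆ D := by
        by_cases hC : η * n ^ 2 ≤ #(schurPairs C)
        · obtain ⟨𝓔, e1, e2, e3⟩ := hn₀ G hn C hC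
          exact ⟨𝓔, e1, fun D hD ↦ .inr (e2 D hD), e3⟩
        · refine ⟨{C}, ?_, fun D hD ↦ .inl ?_, fun I _ hI ↦ ⟨C, by simp, hI⟩⟩
          · simpa using Real.one_le_rpow (by norm_num : (1 : ℝ) ≤ 2) (by positivity)
          · rw [mem_singleton.1 hD]; exact not_le.1 hC
      choose E e1 e2 e3 using hstep
      refine ⟨𝓕.biUnion fun C ↦ if (#(schurPairs C) : ℝ) < η * n ^ 2 then {C} else E C,
        ?_, ?_, ?_⟩
      · calc _ ≤ ∑ C ∈ 𝓕, (#(if (#(schurPairs C) : ℝ) < η * n ^ 2 then {C} else E C) : ℝ) := by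
              exact_mod_cast card_biUnion_le
          _ ≤ ∑ C ∈ 𝓕, (2 : ℝ) ^ (ξ / m * n) := by
              refine sum_le_sum fun C _ ↦ ?_
              split
              · simpa using Real.one_le_rpow (by norm_num : (1 : ℝ) ≤ 2) (by positivity)
              · exact e1 C
          _ = #𝓕 * 2 ^ (ξ / m * n) := by rw [sum_const, nsmul_eq_mul]
          _ ≤ (2 ^ (ξ / m * n)) ^ j * 2 ^ (ξ / m * n) := by gcongr
          _ = _ := (pow_succ _ _).symm
      · intro D hD
        obtain ⟨C, hC, hD⟩ := mem_biUnion.1 hD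
        split at hD
        · rw [mem_singleton.1 hD]; left; assumption
        · rename_i hs
          refine (e2 C D hD).imp_right fun h ↦ ?_
          have := (h2 C hC).resolve_left hs
          push_cast
          linarith
      · intro I hI
        obtain ⟨C, hC, hIC⟩ := h3 I hI
        by_cases hs : (#(schurPairs C) : ℝ) < η * n ^ 2
        · exact ⟨C, mem_biUnion.2 ⟨C, hC, by simp [hs]⟩, hIC⟩
        · obtain ⟨D, hD, hID⟩ := e3 C I hI hIC
          exact ⟨D, mem_biUnion.2 ⟨C, hC, by simpa [hs] using hD⟩, hID⟩
  obtain ⟨𝓕, h1, h2, h3⟩ := key m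
  refine ⟨𝓕, h1.trans_eq ?_, fun D hD ↦ (h2 D hD).resolve_right fun h ↦ ?_, h3⟩
  · rw [← Real.rpow_natCast, ← Real.rpow_mul (by norm_num)]
    congr 1
    field_simp
  · rw [div_lt_iff₀ hη] at hm
    have : (0 : ℝ) ≤ #D := by positivity
    nlinarith

end Containers

section Removal

variable {G : Type} [AddCommGroup G] [Fintype G]

open SimpleGraph TripartiteFromTriangles in
open scoped Classical in
/-- If many Schur triples of `A` are disjoint in a strong sense, then `A` has many Schur triples. -/
lemma triangleRemovalBound_le_card_schurPairs {ε : ℝ} {A : Finset G} {𝓓 : Finset (G × G)}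
    (h𝓓 : 𝓓 ⊆ schurPairs A) (h1 : Set.InjOn (fun p : G × G ↦ p.1) 𝓓)
    (h2 : Set.InjOn (fun p : G × G ↦ p.2) 𝓓) (h3 : Set.InjOn (fun p : G × G ↦ p.1 + p.2) 𝓓)
    (hε : ε * Fintype.card G ≤ #𝓓) :
    27 * triangleRemovalBound (ε / 9) * Fintype.card G ^ 2 ≤ #(schurPairs A) := by
  set n := Fintype.card G with hn
  have hn0 : (0 : ℝ) < n := by exact_mod_cast Fintype.card_pos (α := G)
  let f : G × G × G ↪ G × G × G :=
    ⟨fun q ↦ (q.1, q.1 + q.2.1, q.1 + q.2.1 + q.2.2), by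
      rintro ⟨x, a, b⟩ ⟨x', a', b'⟩ h
      simp only [Prod.mk.injEq] at h
      obtain ⟨rfl, h, h'⟩ := h
      rw [h] at h'
      rw [add_left_cancel h, add_left_cancel h']⟩
  have hf (x a b : G) : f (x, a, b) = (x, x + a, x + a + b) := rfl
  let t : Finset (G × G × G) := (univ ×ˢ 𝓓).map f
  have ht (x y z : G) : (x, y, z) ∈ t ↔ (y - x, z - y) ∈ 𝓓 := by
    simp only [t, mem_map, mem_product, mem_univ, true_and, Prod.exists, hf, Prod.mk.injEq]
    constructor
    · rintro ⟨_, a, b, h, rfl, rfl, rfl⟩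
      simpa using h
    · intro h
      exact ⟨x, y - x, z - y, h, rfl, by abel, by abel⟩
  have : ExplicitDisjoint t := by
    refine ⟨fun a b c a' h h' ↦ ?_, fun a b c b' h h' ↦ ?_, fun a b c c' h h' ↦ ?_⟩
    · rw [ht] at h h'
      have := h2 h h' rfl
      simpa using this
    · rw [ht] at h h'
      have := h3 h h' (by simp)
      simpa using this
    · rw [ht] at h h'
      have := h1 h h' rfl
      simpa using this
  have htc : (#t : ℝ) = n * #𝓓 := by
    simp [t, hn]
  have hfar : (graph t).FarFromTriangleFree (ε / 9) := by
    refine farFromTriangleFree _ ?_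
    rw [htc]
    push_cast
    rw [← hn]
    nlinarith
  have hle := hfar.le_card_cliqueFinset
  have hclique : #((graph t).cliqueFinset 3) ≤ n * #(schurPairs A) := by
    have hsub : (graph t).cliqueFinset 3 ⊆
        (univ ×ˢ schurPairs A).image fun q ↦ toTriangle (f q) := by
      intro s hs
      rw [mem_cliqueFinset_iff, SimpleGraph.is3Clique_iff] at hs
      obtain ⟨x, y, z, hxy, hxz, hyz, rfl⟩ := hs
      obtain ⟨a, b, c, habc, hab, hac, hbc⟩ := graph_triple hxy hxz hyz
      obtain ⟨c', hc'⟩ := Graph.in₀₁_iff.1 hab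
      obtain ⟨b', hb'⟩ := Graph.in₀₂_iff.1 hac
      obtain ⟨a', ha'⟩ := Graph.in₁₂_iff.1 hbc
      rw [ht] at hc' hb' ha'
      have e1 := mem_schurPairs.1 (h𝓓 hc')
      have e2 := mem_schurPairs.1 (h𝓓 hb')
      have e3 := mem_schurPairs.1 (h𝓓 ha')
      refine mem_image.2 ⟨(a, b - a, c - b), ?_, ?_⟩
      · rw [mem_product, mem_schurPairs]
        refine ⟨mem_univ _, e1.1, e3.2.1, ?_⟩
        have := e2.2.2
        simp only at this ⊢
        rwa [show b - a + (c - b) = b' - a + (c - b') by abel]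
      · rw [← habc]
        simp [hf]
    calc _ ≤ _ := card_le_card hsub
      _ ≤ _ := card_image_le
      _ = _ := by rw [card_product, card_univ]
  have hclique' : (#((graph t).cliqueFinset 3) : ℝ) ≤ n * #(schurPairs A) := by
    exact_mod_cast hclique
  have h4 : triangleRemovalBound (ε / 9) * (n + (n + n)) ^ 3 ≤ n * #(schurPairs A) := by
    refine le_trans ?_ hclique'
    convert! hle using 2
    simp [hn]
  have h5 : (27 * triangleRemovalBound (ε / 9) * n ^ 2) * n ≤ #(schurPairs A) * n := by
    linarith
  exact le_of_mul_le_mul_right h5 hn0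

open scoped Classical in
/-- The removal lemma for Schur triples. -/
lemma exists_isSumFree_subset {ε : ℝ} (hε : 0 < ε) : ∃ η : ℝ, 0 < η ∧
    ∀ (G : Type) [AddCommGroup G] [Fintype G] (A : Finset G),
      (#(schurPairs A) : ℝ) < η * Fintype.card G ^ 2 →
      ∃ B ⊆ A, IsSumFree (B : Set G) ∧ (#(A \ B) : ℝ) ≤ ε * Fintype.card G := by
  refine ⟨27 * SimpleGraph.triangleRemovalBound (ε / 3 / 9), ?_, fun G _ _ A hA ↦ ?_⟩
  · have := SimpleGraph.triangleRemovalBound_pos (ε := ε / 3 / 9) (by positivity)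
    positivity
  let P : Finset (Finset (G × G)) := {𝓓 ∈ (schurPairs A).powerset |
    Set.InjOn (fun p : G × G ↦ p.1) 𝓓 ∧ Set.InjOn (fun p : G × G ↦ p.2) 𝓓 ∧
      Set.InjOn (fun p : G × G ↦ p.1 + p.2) 𝓓}
  obtain ⟨𝓓, h𝓓, hmax⟩ := exists_max_image P card ⟨∅, by simp [P]⟩
  simp only [P, mem_filter, mem_powerset] at h𝓓 hmax
  obtain ⟨hs, h1, h2, h3⟩ := h𝓓
  have hcard : (#𝓓 : ℝ) < ε / 3 * Fintype.card G := by
    by_contra! h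
    exact absurd (triangleRemovalBound_le_card_schurPairs hs h1 h2 h3 h) (not_le.2 hA)
  set X : Finset G := 𝓓.image (fun p ↦ p.1) ∪ 𝓓.image (fun p ↦ p.2) ∪ 𝓓.image (fun p ↦ p.1 + p.2)
    with hX
  have hXc : #X ≤ 3 * #𝓓 := by
    have e1 := card_image_le (s := 𝓓) (f := fun p ↦ p.1)
    have e2 := card_image_le (s := 𝓓) (f := fun p ↦ p.2)
    have e3 := card_image_le (s := 𝓓) (f := fun p ↦ p.1 + p.2)
    have e4 := card_union_le (𝓓.image (fun p ↦ p.1) ∪ 𝓓.image (fun p ↦ p.2))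
      (𝓓.image (fun p ↦ p.1 + p.2))
    have e5 := card_union_le (𝓓.image (fun p ↦ p.1)) (𝓓.image (fun p ↦ p.2))
    rw [hX]
    omega
  refine ⟨A \ X, sdiff_subset, fun a ha b hb hab ↦ ?_, ?_⟩
  · simp only [coe_sdiff, Set.mem_sdiff, mem_coe, hX, mem_union, mem_image, not_or,
      not_exists, not_and] at ha hb hab
    have hnot : (a, b) ∉ 𝓓 := fun h ↦ ha.2.1.1 _ h rfl
    have := hmax (insert (a, b) 𝓓) ?_
    · rw [card_insert_of_notMem hnot] at this
      omega
    · refine ⟨insert_subset (mem_schurPairs.2 ⟨ha.1, hb.1, hab.1⟩) hs, ?_, ?_, ?_⟩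
      · rw [coe_insert, Set.injOn_insert (by simpa using hnot)]
        refine ⟨h1, ?_⟩
        rintro ⟨p, hp, h⟩
        exact ha.2.1.1 p hp h
      · rw [coe_insert, Set.injOn_insert (by simpa using hnot)]
        refine ⟨h2, ?_⟩
        rintro ⟨p, hp, h⟩
        exact hb.2.1.2 p hp h
      · rw [coe_insert, Set.injOn_insert (by simpa using hnot)]
        refine ⟨h3, ?_⟩
        rintro ⟨p, hp, h⟩
        exact hab.2.2 p hp h
  · have e1 : #(A \ (A \ X)) ≤ #X := card_le_card fun x ↦ by
      simp only [mem_sdiff]; tauto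
    have e2 : (#(A \ (A \ X)) : ℝ) ≤ 3 * #𝓓 := by exact_mod_cast e1.trans hXc
    linarith

end Removal

section Stability

variable {G : Type} [AddCommGroup G] [Fintype G]

open scoped Classical in
/-- A sum-free set of density greater than `0.47` avoids a subgroup of index two. -/
lemma exists_index_two_of_isSumFree {B : Finset G} (hB : IsSumFree (B : Set G))
    (hcard : 47 * Fintype.card G < 100 * #B) :
    ∃ H : AddSubgroup G, H.index = 2 ∧ ∀ x ∈ B, x ∉ H := by
  set n := Fintype.card G with hn
  have hdisj (X : Finset G) (h : Disjoint X B) : #X + #B ≤ n := by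
    rw [← card_union_of_disjoint h]; exact card_le_univ _
  have hcardadd (a : G) : #(B.image (· + a)) = #B :=
    card_image_of_injective _ (add_left_injective a)
  have hsum : #(image₂ (· + ·) B B) + #B ≤ n := by
    refine hdisj _ (disjoint_left.2 fun x hx hxB ↦ ?_)
    obtain ⟨a, ha, b, hb, rfl⟩ := mem_image₂.1 hx
    exact hB a ha b hb hxB
  have hhalf (b : G) (hb : b ∈ B) : #B + #B ≤ n := by
    have := hdisj (B.image (· + b)) (disjoint_left.2 fun x hx hxB ↦ ?_)
    · rwa [hcardadd] at this
    · obtain ⟨a, ha, rfl⟩ := mem_image.1 hx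
      exact hB a ha b hb hxB
  have hrep (a b : G) (ha : a ∈ B) (hb : b ∈ B) : 3 * #B ≤ #{z ∈ B | z + (a - b) ∈ B} + n := by
    have h1 : B.image (· + a) ∪ B.image (· + b) ⊆ image₂ (· + ·) B B := by
      intro x hx
      obtain hx | hx := mem_union.1 hx <;> obtain ⟨z, hz, rfl⟩ := mem_image.1 hx
      · exact mem_image₂_of_mem hz ha
      · exact mem_image₂_of_mem hz hb
    have h2 : B.image (· + a) ∩ B.image (· + b) ⊆
        ({z ∈ B | z + (a - b) ∈ B} : Finset G).image (· + a) := by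
      intro x hx
      obtain ⟨hx, hx'⟩ := mem_inter.1 hx
      obtain ⟨z, hz, rfl⟩ := mem_image.1 hx
      obtain ⟨w, hw, h⟩ := mem_image.1 hx'
      have h' : w = z + (a - b) := by
        rw [← add_sub_assoc, eq_sub_iff_add_eq]; exact h
      exact mem_image.2 ⟨z, mem_filter.2 ⟨hz, h' ▸ hw⟩, rfl⟩
    have h3 := card_union_add_card_inter (B.image (· + a)) (B.image (· + b))
    have h4 := (card_le_card h2).trans card_image_le
    have h5 := card_le_card h1
    rw [hcardadd, hcardadd] at h3
    omega
  obtain ⟨b₀, hb₀⟩ : B.Nonempty := card_pos.1 (by omega)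
  have hadd (a b c d : G) (ha : a ∈ B) (hb : b ∈ B) (hc : c ∈ B) (hd : d ∈ B) :
      ∃ x ∈ B, ∃ y ∈ B, x - y = (a - b) + (c - d) := by
    have h1 := hrep a b ha hb
    have h2 := hrep d c hd hc
    have h3 := hhalf b₀ hb₀
    have h4 := card_union_add_card_inter ({z ∈ B | z + (a - b) ∈ B} : Finset G)
      {z ∈ B | z + (d - c) ∈ B}
    have h5 : #(({z ∈ B | z + (a - b) ∈ B} : Finset G) ∪ {z ∈ B | z + (d - c) ∈ B}) ≤ #B :=
      card_le_card (union_subset (filter_subset _ _) (filter_subset _ _))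
    obtain ⟨z, hz⟩ := card_pos.1 (show 0 < #(({z ∈ B | z + (a - b) ∈ B} : Finset G) ∩
      {z ∈ B | z + (d - c) ∈ B}) by omega)
    simp only [mem_inter, mem_filter] at hz
    exact ⟨_, hz.1.2, _, hz.2.2, by abel⟩
  let H : AddSubgroup G :=
    { carrier := {x | ∃ a ∈ B, ∃ b ∈ B, a - b = x}
      zero_mem' := ⟨b₀, hb₀, b₀, hb₀, sub_self _⟩
      add_mem' := by
        rintro _ _ ⟨a, ha, b, hb, rfl⟩ ⟨c, hc, d, hd, rfl⟩
        exact hadd a b c d ha hb hc hd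
      neg_mem' := by
        rintro _ ⟨a, ha, b, hb, rfl⟩
        exact ⟨b, hb, a, ha, by abel⟩ }
  have hHB (x : G) (hx : x ∈ B) : x ∉ H := by
    rintro ⟨a, ha, b, hb, h⟩
    exact hB x hx b hb (by rw [← h, sub_add_cancel]; exact ha)
  refine ⟨H, ?_, hHB⟩
  have e1 : #({x | x ∈ H} : Finset G) + #B ≤ n :=
    hdisj _ (disjoint_left.2 fun x hx hxB ↦ hHB x hxB (mem_filter.1 hx).2)
  have e2 : #B ≤ #({x | x ∈ H} : Finset G) := by
    rw [← hcardadd (-b₀)]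
    refine card_le_card fun x hx ↦ ?_
    obtain ⟨a, ha, rfl⟩ := mem_image.1 hx
    exact mem_filter.2 ⟨mem_univ _, a, ha, b₀, hb₀, by abel⟩
  have e3 : Nat.card H = #({x | x ∈ H} : Finset G) := by
    rw [Nat.card_eq_fintype_card, Fintype.card_subtype]
  have e4 := H.card_mul_index
  rw [e3, Nat.card_eq_fintype_card, ← hn] at e4
  set m := #({x | x ∈ H} : Finset G)
  have e5 : H.index < 3 := by
    by_contra! h
    nlinarith
  have e6 : 1 < H.index := by
    by_contra! h
    nlinarith
  omega

end Stability

section Link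

variable {G : Type} [AddCommGroup G]

/-- Two elements are adjacent if together with an element of `S` they form a Schur triple. -/
def schurLink (S : Finset G) : SimpleGraph G where
  Adj x y := x ≠ y ∧ (x + y ∈ S ∨ x - y ∈ S ∨ y - x ∈ S)
  symm := ⟨fun x y h ↦ ⟨h.1.symm, by rw [add_comm]; tauto⟩⟩
  loopless := ⟨fun _ h ↦ h.1 rfl⟩

lemma schurLink_adj {S : Finset G} {x y : G} :
    (schurLink S).Adj x y ↔ x ≠ y ∧ (x + y ∈ S ∨ x - y ∈ S ∨ y - x ∈ S) := Iff.rfl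

lemma schurLink_mono {S T : Finset G} (h : S ⊆ T) : schurLink S ≤ schurLink T := by
  intro x y hxy
  rw [schurLink_adj] at hxy ⊢
  exact ⟨hxy.1, hxy.2.imp (@h _) (Or.imp (@h _) (@h _))⟩

lemma IsSumFree.mono {A B : Set G} (hB : IsSumFree B) (h : A ⊆ B) : IsSumFree A :=
  fun x hx y hy hxy ↦ hB x (h hx) y (h hy) (h hxy)

variable [Fintype G]

open scoped Classical in
/-- The family of maximal sum-free sets, as finsets. -/
noncomputable def maxSumFree (G : Type) [AddCommGroup G] [Fintype G] : Finset (Finset G) :=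
  {I | IsMaximalSumFree (I : Set G)}

lemma mem_maxSumFree {I : Finset G} : I ∈ maxSumFree G ↔ IsMaximalSumFree (I : Set G) := by
  simp [maxSumFree]

open scoped Classical in
/-- Maximal sum-free sets with a prescribed part outside a sum-free set `W` correspond to maximal
independent sets of the link graph. -/
lemma card_maxSumFree_filter_sdiff_le {W S : Finset G} (hW : IsSumFree (W : Set G)) :
    #{I ∈ maxSumFree G | I \ W = S} ≤
      #(misFamily (schurLink S) {x ∈ W | IsSumFree ((insert x S : Finset G) : Set G)}) := by
  refine card_le_card_of_injOn (fun I ↦ I ∩ W) ?_ ?_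
  · intro I hI
    simp only [coe_filter, Set.mem_ofPred_eq, mem_maxSumFree] at hI
    obtain ⟨⟨hI, hmax⟩, rfl⟩ := hI
    rw [mem_coe, mem_misFamily]
    refine ⟨fun x hx ↦ ?_, fun x hx y hy hxy ↦ ?_, fun x hx hxI ↦ ?_⟩
    · rw [mem_inter] at hx
      refine mem_filter.2 ⟨hx.2, hI.mono ?_⟩
      rw [coe_subset]
      exact insert_subset hx.1 sdiff_subset
    · rw [mem_inter] at hx hy
      obtain ⟨-, h | h | h⟩ := hxy <;> rw [mem_sdiff] at h
      · exact hI x hx.1 y hy.1 h.1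
      · exact hI y hy.1 (x - y) h.1 (by simpa using hx.1)
      · exact hI x hx.1 (y - x) h.1 (by simpa using hy.1)
    · rw [mem_filter] at hx
      obtain ⟨hxW, hxS⟩ := hx
      have hxI' : x ∉ I := fun h ↦ hxI (mem_inter.2 ⟨h, hxW⟩)
      by_contra! hcon
      have hno : ∀ y ∈ I, y ∈ W → x + y ∉ I \ W ∧ x - y ∉ I \ W ∧ y - x ∉ I \ W := by
        intro y hy hyW
        have h1 := hcon y (mem_inter.2 ⟨hy, hyW⟩)
        have h2 : x ≠ y := fun h ↦ hxI' (h ▸ hy)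
        rw [schurLink_adj] at h1
        tauto
      have hnot : ¬ IsSumFree ((insert x I : Finset G) : Set G) := by
        intro h
        have := hmax _ h (by simp)
        exact hxI' (by rw [← mem_coe, this]; simp)
      unfold IsSumFree at hnot
      push Not at hnot
      obtain ⟨a, ha, b, hb, hc⟩ := hnot
      have hsplit (z : G) (hz : z ∈ ((insert x I : Finset G) : Set G)) :
          z = x ∨ (z ∈ I ∧ z ∈ W) ∨ z ∈ I \ W := by
        rw [mem_coe, mem_insert] at hz
        rw [mem_sdiff]
        tauto
      have hxS' : ∀ u ∈ insert x (I \ W), ∀ v ∈ insert x (I \ W), u + v ∉ insert x (I \ W) := hxS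
      have hI' : ∀ u ∈ I, ∀ v ∈ I, u + v ∉ I := hI
      have hW' : ∀ u ∈ W, ∀ v ∈ W, u + v ∉ W := hW
      have hSI : ∀ u ∈ I \ W, u ∈ I := fun u hu ↦ (mem_sdiff.1 hu).1
      have hJS : ∀ u ∈ I \ W, u ∈ insert x (I \ W) := fun u hu ↦ mem_insert_of_mem hu
      have hx' : x ∈ insert x (I \ W) := mem_insert_self _ _
      have e1 : a + b - a = b := add_sub_cancel_left a b
      have e2 : a + b - b = a := add_sub_cancel_right a b
      have e3 : a + b = b + a := add_comm a b
      obtain ha0 | ⟨ha, ha'⟩ | ha := hsplit a ha <;> obtain hb0 | ⟨hb, hb'⟩ | hb := hsplit b hb <;>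
        obtain hc0 | ⟨hc, hc'⟩ | hc := hsplit _ hc
      all_goals grind only
  · intro I hI J hJ h
    simp only [coe_filter, Set.mem_ofPred_eq] at hI hJ
    rw [← sdiff_union_inter I W, ← sdiff_union_inter J W, hI.2, hJ.2]
    exact congrArg _ h

end Link

section Twins

variable {V : Type*} [DecidableEq V] {Γ : SimpleGraph V} {U : Finset V}

lemma exists_transversal {σ : V → V} (hσ : ∀ x, σ (σ x) = x) (hU : ∀ x ∈ U, σ x ∈ U) :
    ∃ R ⊆ U, (∀ x ∈ U, x ∈ R ∨ σ x ∈ R) ∧ 2 * #R ≤ #U + #{x ∈ U | σ x = x} := by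
  obtain ⟨R, hR, hmin⟩ := exists_min_image {R ∈ U.powerset | ∀ x ∈ U, x ∈ R ∨ σ x ∈ R} card
    ⟨U, by simp; tauto⟩
  simp only [mem_filter, mem_powerset] at hR hmin
  refine ⟨R, hR.1, hR.2, ?_⟩
  have key (x : V) (hx : x ∈ R) (hx' : σ x ≠ x) : σ x ∉ R := by
    intro hσx
    have := hmin (R.erase x) ⟨(erase_subset _ _).trans hR.1, fun y hy ↦ ?_⟩
    · have h2 := card_erase_lt_of_mem hx
      omega
    · by_cases hyx : y = x
      · subst hyx
        exact .inr (mem_erase.2 ⟨hx', hσx⟩)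
      · by_cases hyx' : σ y = x
        · left
          rw [← hyx', hσ] at hσx
          exact mem_erase.2 ⟨hyx, hσx⟩
        · exact (hR.2 y hy).imp (fun h ↦ mem_erase.2 ⟨hyx, h⟩) (fun h ↦ mem_erase.2 ⟨hyx', h⟩)
  have hdisj : Disjoint R ({x ∈ R | ¬ σ x = x}.image σ) := by
    rw [disjoint_right]
    intro y hy
    obtain ⟨x, hx, rfl⟩ := mem_image.1 hy
    rw [mem_filter] at hx
    exact key x hx.1 hx.2
  have h1 : #(R ∪ {x ∈ R | ¬ σ x = x}.image σ) ≤ #U := by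
    refine card_le_card (union_subset hR.1 fun y hy ↦ ?_)
    obtain ⟨x, hx, rfl⟩ := mem_image.1 hy
    exact hU x (hR.1 (mem_filter.1 hx).1)
  rw [card_union_of_disjoint hdisj, card_image_of_injective _
    (Function.LeftInverse.injective hσ)] at h1
  have h2 := card_filter_add_card_filter_not (s := R) (fun x ↦ σ x = x)
  have h3 : #{x ∈ R | σ x = x} ≤ #{x ∈ U | σ x = x} := card_le_card (filter_subset_filter _ hR.1)
  omega

/-- If `σ` pairs up twins, then only one vertex from each pair matters. -/
lemma card_misFamily_le_of_twins {σ : V → V} {R : Finset V} (hRU : R ⊆ U)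
    (hR : ∀ x ∈ U, x ∈ R ∨ σ x ∈ R) (hσ : ∀ x ∈ U, σ (σ x) = x) (hU : ∀ x ∈ U, σ x ∈ U)
    (had : ∀ x ∈ U, ∀ y ∈ U, Γ.Adj x y → Γ.Adj (σ x) y) :
    #(misFamily Γ U) ≤ #(misFamily Γ R) := by
  have key (I : Finset V) (hI : I ∈ misFamily Γ U) (x : V) (hx : x ∈ I) : σ x ∈ I := by
    rw [mem_misFamily] at hI
    by_contra h
    obtain ⟨y, hy, hxy⟩ := hI.2.2 (σ x) (hU x (hI.1 hx)) h
    have := had _ (hU x (hI.1 hx)) y (hI.1 hy) hxy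
    rw [hσ x (hI.1 hx)] at this
    exact hI.2.1 x hx y hy this
  refine card_le_card_of_injOn (fun I ↦ I ∩ R) ?_ ?_
  · intro I hI
    rw [mem_coe] at hI
    have hσI := key I hI
    rw [mem_misFamily] at hI
    rw [mem_coe, mem_misFamily]
    refine ⟨inter_subset_right, fun x hx y hy ↦ hI.2.1 x (mem_inter.1 hx).1 y (mem_inter.1 hy).1,
      fun x hx hxI ↦ ?_⟩
    obtain ⟨y, hy, hxy⟩ := hI.2.2 x (hRU hx) (fun h ↦ hxI (mem_inter.2 ⟨h, hx⟩))
    obtain h | h := hR y (hI.1 hy)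
    · exact ⟨y, mem_inter.2 ⟨hy, h⟩, hxy⟩
    · exact ⟨σ y, mem_inter.2 ⟨hσI y hy, h⟩,
        (had y (hI.1 hy) x (hRU hx) hxy.symm).symm⟩
  · intro I hI J hJ h
    rw [mem_coe] at hI hJ
    have aux (I J : Finset V) (hI : I ∈ misFamily Γ U) (hJ : J ∈ misFamily Γ U)
        (h : I ∩ R = J ∩ R) : I ⊆ J := by
      intro x hx
      have hxU := (mem_misFamily.1 hI).1 hx
      obtain hxR | hxR := hR x hxU
      · have : x ∈ J ∩ R := h ▸ mem_inter.2 ⟨hx, hxR⟩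
        exact (mem_inter.1 this).1
      · have : σ x ∈ J ∩ R := h ▸ mem_inter.2 ⟨key I hI x hx, hxR⟩
        have := key J hJ _ (mem_inter.1 this).1
        rwa [hσ x hxU] at this
    exact (aux I J hI hJ h).antisymm (aux J I hJ hI h.symm)

end Twins

section Log

variable {V : Type*} {Γ : SimpleGraph V}

set_option exponentiation.threshold 400 in
lemma three_le_two_rpow : (3 : ℝ) ≤ 2 ^ (1.585 : ℝ) := by
  have h : (3 : ℝ) ^ 200 ≤ ((2 : ℝ) ^ (1.585 : ℝ)) ^ 200 := by
    rw [← Real.rpow_natCast, ← Real.rpow_natCast, ← Real.rpow_mul (by norm_num)]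
    norm_num
  exact le_of_pow_le_pow_left₀ (by norm_num) (by positivity) h

lemma card_misFamily_le_two_rpow (U : Finset V) :
    (#(misFamily Γ U) : ℝ) ≤ 2 ^ (0.5284 * #U : ℝ) := by
  refine (card_misFamily_le_pow (r := 3 ^ (1 / 3 : ℝ)) (by positivity) ?_ U).trans ?_
  · rw [← Real.rpow_natCast, ← Real.rpow_mul (by norm_num)]; norm_num
  · rw [Real.rpow_mul (by norm_num), Real.rpow_natCast]
    gcongr
    calc (3 : ℝ) ^ (1 / 3 : ℝ) ≤ (2 ^ (1.585 : ℝ)) ^ (1 / 3 : ℝ) := by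
          gcongr; exact three_le_two_rpow
      _ = 2 ^ (1.585 * (1 / 3) : ℝ) := (Real.rpow_mul (by norm_num) _ _).symm
      _ ≤ 2 ^ (0.5284 : ℝ) := Real.rpow_le_rpow_of_exponent_le (by norm_num) (by norm_num)

lemma card_misFamily_le_two_rpow_half (U : Finset V)
    (hU : ∀ x ∈ U, ∀ y ∈ U, ∀ z ∈ U, Γ.Adj x y → Γ.Adj y z → ¬ Γ.Adj x z) :
    (#(misFamily Γ U) : ℝ) ≤ 2 ^ (1 / 2 * #U : ℝ) := by
  refine (card_misFamily_le_pow_of_triangleFree (r := 2 ^ (1 / 2 : ℝ)) (by positivity) ?_ U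
    hU).trans_eq ?_
  · rw [← Real.rpow_natCast, ← Real.rpow_mul (by norm_num)]; norm_num
  · rw [Real.rpow_mul (by norm_num), Real.rpow_natCast]

end Log

section OddCoset

variable {G : Type} [AddCommGroup G] [Fintype G]

open scoped Classical in
/-- The number of elements of `G` of order at most two. -/
noncomputable def twoTorsionCard (G : Type) [AddCommGroup G] [Fintype G] : ℕ :=
  #{x : G | x + x = 0}

open scoped Classical in
lemma card_filter_add_self_eq_le (c : G) : #{x : G | x + x = c} ≤ twoTorsionCard G := by
  obtain h | ⟨x₀, hx₀⟩ := ({x : G | x + x = c} : Finset G).eq_empty_or_nonempty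
  · rw [h]; simp
  · have hx₀' := (mem_filter.1 hx₀).2
    refine card_le_card_of_injOn (· - x₀) (fun x hx ↦ ?_) (sub_left_injective.injOn)
    simp only [coe_filter, mem_univ, true_and, Set.mem_ofPred_eq] at hx ⊢
    rw [sub_add_sub_comm, hx, hx₀', sub_self]

open scoped Classical in
lemma card_filter_add_self_mem_le (E : Finset G) :
    #{x : G | x + x ∈ E} ≤ #E * twoTorsionCard G := by
  have h : ({x : G | x + x ∈ E} : Finset G) ⊆ E.biUnion fun c ↦ {x : G | x + x = c} := by
    intro x hx
    simpa using hx
  refine (card_le_card h).trans (card_biUnion_le.trans ?_)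
  exact sum_le_card_nsmul _ _ _ fun c _ ↦ card_filter_add_self_eq_le c

open scoped Classical in
/-- The complement of a subgroup. -/
noncomputable def oddCoset (H : AddSubgroup G) : Finset G := {x | x ∉ H}

lemma mem_oddCoset {H : AddSubgroup G} {x : G} : x ∈ oddCoset H ↔ x ∉ H := by simp [oddCoset]

variable {H : AddSubgroup G}

lemma two_mul_card_oddCoset (hH : H.index = 2) : 2 * #(oddCoset H) = Fintype.card G := by
  classical
  have h1 := H.card_mul_index
  rw [hH, Nat.card_eq_fintype_card, Nat.card_eq_fintype_card, Fintype.card_subtype] at h1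
  have h2 := card_filter_add_card_filter_not (s := (univ : Finset G)) (fun x ↦ x ∈ H)
  rw [card_univ] at h2
  have h3 : #(oddCoset H) = #{x : G | x ∉ H} := by unfold oddCoset; congr!
  omega

lemma isSumFree_oddCoset (hH : H.index = 2) : IsSumFree (oddCoset H : Set G) := by
  intro x hx y hy hxy
  rw [mem_coe, mem_oddCoset] at hx hy hxy
  rw [AddSubgroup.add_mem_iff_of_index_two hH] at hxy
  tauto

omit [Fintype G] in
lemma isSumFree_insert_iff [DecidableEq G] {S : Finset G} (hH : H.index = 2)
    (hS : IsSumFree (S : Set G)) (hSH : ∀ s ∈ S, s ∈ H) {x : G} (hx : x ∉ H) :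
    IsSumFree ((insert x S : Finset G) : Set G) ↔ x + x ∉ S := by
  refine ⟨fun h hxx ↦ h x (by simp) x (by simp) (by simp [hxx]), fun h a ha b hb hab ↦ ?_⟩
  simp only [coe_insert, Set.mem_insert_iff, mem_coe] at ha hb hab
  have h2 := AddSubgroup.add_mem_iff_of_index_two hH (a := a) (b := b)
  have h0 : (0 : G) ∉ S := fun h0 ↦ hS 0 h0 0 h0 (by simpa using h0)
  obtain rfl | ha := ha <;> obtain rfl | hb := hb <;> obtain hc | hc := hab
  · rw [add_eq_left] at hc; subst hc; exact hx H.zero_mem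
  · exact h hc
  · simp only [add_eq_left] at hc; subst hc; exact h0 hb
  · have := hSH _ hc; have := hSH _ hb; tauto
  · simp only [add_eq_right] at hc; subst hc; exact h0 ha
  · have := hSH _ hc; have := hSH _ ha; tauto
  · rw [hc] at h2; have := hSH _ ha; have := hSH _ hb; tauto
  · exact hS a ha b hb hc

omit [Fintype G] in
lemma card_nbhdIn_schurLink_le [DecidableEq G] {S : Finset G} (U : Finset G) (x : G) :
    #(nbhdIn (schurLink S) U x) ≤ #(S ∪ S.image Neg.neg) + #S := by
  have h : nbhdIn (schurLink S) U x ⊆ (S ∪ S.image Neg.neg).image (x + ·) ∪ S.image (· - x) := by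
    intro y hy
    obtain ⟨-, -, h | h | h⟩ := mem_nbhdIn.1 hy
    · exact mem_union_right _ (mem_image.2 ⟨_, h, by abel⟩)
    · exact mem_union_left _ (mem_image.2 ⟨-(x - y), mem_union_right _ (mem_image.2 ⟨_, h, rfl⟩),
        by abel⟩)
    · exact mem_union_left _ (mem_image.2 ⟨_, mem_union_left _ h, by abel⟩)
  exact (card_le_card h).trans ((card_union_le _ _).trans
    (Nat.add_le_add card_image_le card_image_le))

lemma le_adjPairs_schurLink [DecidableEq G] {S : Finset G}
    (hSH : ∀ s ∈ S, s ∈ H) (h0 : 0 ∉ S) :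
    (#(S ∪ S.image Neg.neg) + #S) * #(oddCoset H) ≤ adjPairs (schurLink S) (oddCoset H) +
      (#(S ∪ S.image Neg.neg) + #S) * (#S * (#(S ∪ S.image Neg.neg) + 1) * twoTorsionCard G) := by
  set T := S ∪ S.image Neg.neg with hT
  set E : Finset G := image₂ (· - ·) S (insert 0 T)
  set bad : Finset G := {x : G | x + x ∈ E}
  have hTneg (t : G) (ht : t ∈ T) : t ∈ S ∨ -t ∈ S := by
    obtain h | h := mem_union.1 ht
    · exact .inl h
    · obtain ⟨s, hs, rfl⟩ := mem_image.1 h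
      exact .inr (by simpa using hs)
  have hbad : #bad ≤ #S * (#T + 1) * twoTorsionCard G := by
    refine le_trans (le_of_eq_of_le (by simp only [bad]; congr!) (card_filter_add_self_mem_le E))
      (Nat.mul_le_mul_right _ ?_)
    exact (card_image₂_le _ _ _).trans (Nat.mul_le_mul_left _ (card_insert_le _ _))
  have hdeg (x : G) (hx : x ∈ oddCoset H) (hxb : x ∉ bad) :
      #T + #S ≤ #(nbhdIn (schurLink S) (oddCoset H) x) := by
    have hxE : x + x ∉ E := fun h ↦ hxb (mem_filter.2 ⟨mem_univ _, h⟩)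
    rw [mem_oddCoset] at hx
    have h1 : T.image (x + ·) ∪ S.image (· - x) ⊆ nbhdIn (schurLink S) (oddCoset H) x := by
      intro y hy
      rw [mem_nbhdIn, mem_oddCoset, schurLink_adj]
      obtain hy | hy := mem_union.1 hy
      · obtain ⟨t, ht, rfl⟩ := mem_image.1 hy
        have ht' := hTneg t ht
        have htH : t ∈ H := ht'.elim (hSH t) (fun h ↦ by simpa using hSH _ h)
        refine ⟨fun h ↦ hx (by simpa using H.sub_mem h htH), fun h ↦ ?_, .inr ?_⟩
        · have : t = 0 := by simpa using h
          subst this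
          rw [neg_zero, or_self] at ht'
          exact h0 ht'
        · rw [sub_add_cancel_left, add_sub_cancel_left]
          exact ht'.symm
      · obtain ⟨s, hs, rfl⟩ := mem_image.1 hy
        refine ⟨fun h ↦ hx (by simpa using H.sub_mem (hSH s hs) h), fun h ↦ ?_,
          .inl (by simpa using hs)⟩
        exact hxE (mem_image₂.2 ⟨s, hs, 0, by simp, by
          rw [sub_zero]; exact (eq_sub_iff_add_eq.1 h).symm⟩)
    have h2 : Disjoint (T.image (x + ·)) (S.image (· - x)) := by
      rw [disjoint_left]
      intro y hy hy'
      obtain ⟨t, ht, rfl⟩ := mem_image.1 hy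
      obtain ⟨s, hs, h⟩ := mem_image.1 hy'
      refine hxE (mem_image₂.2 ⟨s, hs, t, by simp [ht], ?_⟩)
      rw [sub_eq_iff_eq_add] at h ⊢
      rw [h]; abel
    have h3 := card_le_card h1
    rwa [card_union_of_disjoint h2, card_image_of_injective _ (add_right_injective x),
      card_image_of_injective _ (sub_left_injective)] at h3
  have h4 : #(oddCoset H) ≤ #(oddCoset H \ bad) + #bad := by
    rw [← tsub_le_iff_right]
    exact le_card_sdiff _ _
  have h5 : #(oddCoset H \ bad) * (#T + #S) ≤ adjPairs (schurLink S) (oddCoset H) := by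
    calc _ ≤ ∑ x ∈ oddCoset H \ bad, #(nbhdIn (schurLink S) (oddCoset H) x) :=
          card_nsmul_le_sum _ _ _ fun x hx ↦
            hdeg x (mem_sdiff.1 hx).1 (mem_sdiff.1 hx).2
      _ ≤ _ := sum_le_sum_of_subset sdiff_subset
  calc (#T + #S) * #(oddCoset H) ≤ (#T + #S) * (#(oddCoset H \ bad) + #bad) := by gcongr
    _ = #(oddCoset H \ bad) * (#T + #S) + (#T + #S) * #bad := by ring
    _ ≤ _ := by gcongr

/-- The branching bound for link graphs on the odd coset. -/
lemma card_misFamily_schurLink_le [DecidableEq G] {S S' : Finset G}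
    (hSS' : S' ⊆ S) (hSH : ∀ s ∈ S', s ∈ H) (h0 : 0 ∉ S') (hne : S'.Nonempty) {d k : ℕ}
    (hd : d = #(S' ∪ S'.image Neg.neg) + #S')
    {a b l : ℝ} (hb : 0 ≤ b) (hbr : (2 : ℝ) ^ (-(a - b)) + 2 ^ (-((k + 2) * (a - b))) ≤ 1)
    (hab : b ≤ a) (hl : l ≤ a - b * k / (2 * d)) {W : Finset G} (hW : W ⊆ oddCoset H)
    (hleaf : ∀ X ⊆ W, (#(misFamily (schurLink S) X) : ℝ) ≤ 2 ^ (l * #X)) :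
    (#(misFamily (schurLink S) W) : ℝ) ≤
      2 ^ ((a - b / 2) * #(oddCoset H) + b / 2 * (#S' * (d + 1) * twoTorsionCard G)) := by
  have hd0 : 0 < d := by have := hne.card_pos; omega
  have hd0' : (0 : ℝ) < d := by exact_mod_cast hd0
  have hdeg (U : Finset G) (x : G) : #(nbhdIn (schurLink S') U x) ≤ d :=
    hd ▸ card_nbhdIn_schurLink_le U x
  refine (card_misFamily_le_of_branching (schurLink_mono hSS') hd0 hb hbr hab hl
    (fun v _ ↦ hdeg W v) hleaf).trans
    (Real.rpow_le_rpow_of_exponent_le (by norm_num) ?_)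
  have h1 := adjPairs_le_add (Γ := schurLink S') (U := oddCoset H) (fun v _ ↦ hdeg _ v) hW
  have h2 := le_adjPairs_schurLink hSH h0
  rw [← hd] at h2
  have h3 : #(oddCoset H \ W) + #W = #(oddCoset H) := card_sdiff_add_card_eq_card hW
  have h4 : d * #(oddCoset H) ≤ adjPairs (schurLink S') W + 2 * d * #(oddCoset H \ W) +
      d * (#S' * (d + 1) * twoTorsionCard G) := by
    refine h2.trans (Nat.add_le_add h1 ?_)
    gcongr
    omega
  have h4' : (d : ℝ) * #(oddCoset H) ≤ adjPairs (schurLink S') W + 2 * d * #(oddCoset H \ W) +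
      d * (#S' * (d + 1) * twoTorsionCard G) := by exact_mod_cast h4
  have h3' : (#(oddCoset H \ W) : ℝ) = #(oddCoset H) - #W := by
    rw [eq_sub_iff_add_eq]; exact_mod_cast h3
  have h5 : (0 : ℝ) ≤ #(oddCoset H \ W) := by positivity
  have h6 : b / (2 * d) * (d * #(oddCoset H)) ≤ b / (2 * d) * (adjPairs (schurLink S') W +
      2 * d * #(oddCoset H \ W) + d * (#S' * (d + 1) * twoTorsionCard G)) := by gcongr
  have h7 : b / (2 * d) * (d * #(oddCoset H)) = b / 2 * #(oddCoset H) := by field_simp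
  have h8 : b / (2 * d) * (adjPairs (schurLink S') W +
      2 * d * #(oddCoset H \ W) + d * (#S' * (d + 1) * twoTorsionCard G)) =
      b / (2 * d) * adjPairs (schurLink S') W + b * #(oddCoset H \ W) +
        b / 2 * (#S' * (d + 1) * twoTorsionCard G) := by field_simp
  rw [h7, h8] at h6
  have h9 : b * #(oddCoset H \ W) ≤ a * #(oddCoset H \ W) := by gcongr
  rw [h3'] at h6 h9
  linarith

end OddCoset

section Prisms

variable {G : Type} [AddCommGroup G]

lemma schurLink_singleton_adj {s u z : G} (hs : s ≠ 0) (hu : u + u ≠ s) :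
    (schurLink {s}).Adj u z ↔ z = s - u ∨ z = u + s ∨ z = u - s := by
  simp only [schurLink_adj, mem_singleton]
  constructor
  · rintro ⟨-, h | h | h⟩
    · left; rw [← h]; abel
    · right; right; rw [← h]; abel
    · right; left; rw [← h]; abel
  · rintro (rfl | rfl | rfl)
    · exact ⟨fun h ↦ hu (eq_sub_iff_add_eq.1 h), .inl (by abel)⟩
    · exact ⟨fun h ↦ hs (by simpa using h), .inr (.inr (by abel))⟩
    · exact ⟨fun h ↦ hs (sub_eq_self.1 h.symm), .inr (.inl (by abel))⟩

variable [DecidableEq G]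

/-- The triangle of `x` in the link graph of an element `s` of order three. -/
def linkTriangle (s x : G) : Finset G := {x, x + s, x - s}

/-- The component of `x` in the link graph of an element `s` of order three. -/
def linkPrism (s x : G) : Finset G := linkTriangle s x ∪ linkTriangle s (-x)

lemma mem_linkPrism {s x z : G} : z ∈ linkPrism s x ↔
    z = x ∨ z = x + s ∨ z = x - s ∨ z = -x ∨ z = -x + s ∨ z = -x - s := by
  simp only [linkPrism, linkTriangle, mem_union, mem_insert, mem_singleton, or_assoc]

variable {s : G}

lemma linkPrism_eq_of_mem (h3 : s + s = -s) {x u : G} (hu : u ∈ linkPrism s x) :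
    linkPrism s u = linkPrism s x := by
  have e1 (y : G) : y + s + s = y - s := by rw [add_assoc, h3, sub_eq_add_neg]
  have e2 (y : G) : y - s - s = y + s := by
    rw [sub_sub, h3, sub_neg_eq_add]
  ext z
  rw [mem_linkPrism] at hu ⊢
  rw [mem_linkPrism]
  obtain rfl | rfl | rfl | rfl | rfl | rfl := hu <;>
    simp only [neg_add, neg_sub', neg_neg, sub_neg_eq_add, ← sub_eq_add_neg, e1, e2,
      add_sub_cancel_right, sub_add_cancel] <;> tauto

lemma card_linkPrism (h3 : s + s = -s) (hs : s ≠ 0) {x : G} (hx : x + x ≠ 0) (hx' : x + x ≠ s)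
    (hx'' : x + x ≠ -s) : #(linkPrism s x) = 6 := by
  have hT (y : G) : #(linkTriangle s y) = 3 := by
    refine card_eq_three.2 ⟨y, y + s, y - s, by simpa using hs, ?_, ?_, rfl⟩
    · intro h
      rw [eq_comm, sub_eq_self] at h
      exact hs h
    · intro h
      rw [sub_eq_add_neg, add_right_inj, ← h3, left_eq_add] at h
      exact hs h
  rw [linkPrism, card_union_of_disjoint, hT, hT]
  rw [disjoint_left]
  intro z hz hz'
  simp only [linkTriangle, mem_insert, mem_singleton] at hz hz'
  have key {a b : G} (ha : z = x + a) (hb : z = -x + b) : x + x = b - a := by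
    rw [eq_sub_iff_add_eq, add_assoc, ← ha, hb, add_neg_cancel_left]
  have h3' : -s - s = s := by rw [sub_eq_add_neg, ← neg_add, h3, neg_neg]
  have hz0 : z = x + 0 ∨ z = x + s ∨ z = x + -s := by simpa [sub_eq_add_neg] using hz
  have hz1 : z = -x + 0 ∨ z = -x + s ∨ z = -x + -s := by simpa [sub_eq_add_neg] using hz'
  obtain h | h | h := hz0 <;> obtain h' | h' | h' := hz1 <;>
    have hk := key h h' <;>
    simp only [sub_self, sub_zero, zero_sub, sub_neg_eq_add, h3, h3', zero_add]
      at hk <;> contradiction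

/-- The link graph of an element of order three is a union of prisms. -/
lemma card_misFamily_schurLink_le_of_three [Fintype G] (h3 : s + s = -s) (hs : s ≠ 0) {U : Finset G}
    (hU : ∀ x ∈ U, -x ∈ U ∧ x + s ∈ U) (hne : ∀ x ∈ U, x + x ≠ 0 ∧ x + x ≠ s ∧ x + x ≠ -s) :
    (#(misFamily (schurLink {s}) U) : ℝ) ≤ 2 ^ (0.435 * #U : ℝ) := by
  have e1 (y : G) : y + s + s = y - s := by rw [add_assoc, h3, sub_eq_add_neg]
  have e2 (y : G) : y - s - s = y + s := by
    rw [sub_sub, h3, sub_neg_eq_add]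
  have e3 (y : G) : s - y = -y + s := by abel
  induction U using Finset.strongInduction with
  | H U ih =>
  obtain rfl | ⟨x, hx⟩ := U.eq_empty_or_nonempty
  · simpa using card_misFamily_empty (Γ := schurLink {s})
  have hsub (u : G) (hu : u ∈ U) : u - s ∈ U := by
    rw [← e1]; exact (hU _ (hU _ hu).2).2
  have hCU (u : G) (hu : u ∈ U) : linkPrism s u ⊆ U := by
    intro z hz
    rw [mem_linkPrism] at hz
    have h1 := hU u hu
    have h2 := hU _ h1.1
    have h3 := hsub u hu
    have h4 := hsub _ h1.1
    obtain rfl | rfl | rfl | rfl | rfl | rfl := hz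
    exacts [hu, h1.2, h3, h1.1, h2.2, h4]
  have hadj (u z : G) (hu : u ∈ U) :
      (schurLink {s}).Adj u z ↔ z = -u + s ∨ z = u + s ∨ z = u - s := by
    rw [schurLink_singleton_adj hs (hne u hu).2.1, e3]
  have hbranch (u : G) (hu : u ∈ U) : #(misFamily (schurLink {s}) (outsideNbhd (schurLink {s}) U u))
      ≤ 2 * #(misFamily (schurLink {s}) (U \ linkPrism s u)) := by
    have hnu := hU u hu
    have hw : -u ∈ outsideNbhd (schurLink {s}) U u := by
      rw [mem_outsideNbhd, hadj u _ hu]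
      have := hne u hu
      refine ⟨hnu.1, fun h ↦ this.1 ?_, ?_⟩
      · nth_rewrite 1 [← h]; simp
      · rintro (h | h | h)
        · exact hs (by simpa using h)
        · refine this.2.2 ?_
          rw [← add_eq_zero_iff_eq_neg, add_assoc, ← h, add_neg_cancel]
        · refine this.2.1 ?_
          rw [← sub_eq_zero, add_sub_assoc, ← h, add_neg_cancel]
    refine (card_misFamily_le_sum_nbhdIn hw).trans ?_
    have hsubset : insert (-u) (nbhdIn (schurLink {s}) (outsideNbhd (schurLink {s}) U u) (-u)) ⊆
        {-u, -u - s} := by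
      intro z hz
      obtain rfl | hz := mem_insert.1 hz
      · simp
      · rw [mem_nbhdIn, mem_outsideNbhd, hadj u _ hu, hadj _ _ hnu.1, neg_neg] at hz
        rw [mem_insert, mem_singleton]
        tauto
    have hterm : ∀ w ∈ insert (-u) (nbhdIn (schurLink {s}) (outsideNbhd (schurLink {s}) U u) (-u)),
        outsideNbhd (schurLink {s}) (outsideNbhd (schurLink {s}) U u) w = U \ linkPrism s u := by
      intro w hw
      have hw' := hsubset hw
      rw [mem_insert, mem_singleton] at hw'
      ext z
      obtain rfl | rfl := hw'
      · rw [mem_outsideNbhd, mem_outsideNbhd, hadj u _ hu, hadj _ _ hnu.1, neg_neg, mem_sdiff,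
          mem_linkPrism]
        tauto
      · rw [mem_outsideNbhd, mem_outsideNbhd, hadj u _ hu, hadj _ _ (hsub _ hnu.1), mem_sdiff,
          mem_linkPrism, sub_add_cancel, e2, neg_sub', neg_neg, sub_neg_eq_add, e1]
        tauto
    rw [sum_congr rfl fun w hw ↦ by rw [hterm w hw], sum_const, smul_eq_mul]
    exact Nat.mul_le_mul_right _ ((card_le_card hsubset).trans card_le_two)
  have hmeet : ∀ I ∈ misFamily (schurLink {s}) U, ∃ u ∈ linkTriangle s x, u ∈ I := by
    intro I hI
    rw [mem_misFamily] at hI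
    by_contra! hcon
    have h1 := hcon x (by simp [linkTriangle])
    have h2 := hcon (x + s) (by simp [linkTriangle])
    have h3 := hcon (x - s) (by simp [linkTriangle])
    obtain ⟨y, hy, hxy⟩ := hI.2.2 x hx h1
    obtain ⟨z, hz, hxz⟩ := hI.2.2 (x + s) (hU x hx).2 h2
    rw [hadj _ _ hx] at hxy
    rw [hadj _ _ (hU x hx).2, e1, add_sub_cancel_right, neg_add, neg_add_cancel_right] at hxz
    have hy' : y = -x + s := by
      obtain h | rfl | rfl := hxy
      exacts [h, (h2 hy).elim, (h3 hy).elim]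
    have hz' : z = -x := by
      obtain h | rfl | rfl := hxz
      exacts [h, (h3 hz).elim, (h1 hz).elim]
    subst hy' hz'
    exact hI.2.1 _ hz _ hy ((hadj _ _ (hU x hx).1).2 (by simp))
  have hle := card_misFamily_le_sum (linkTriangle s x) hmeet
  have hCx : #(linkPrism s x) = 6 := card_linkPrism h3 hs (hne x hx).1 (hne x hx).2.1 (hne x hx).2.2
  have hle' : #(misFamily (schurLink {s}) U) ≤
      6 * #(misFamily (schurLink {s}) (U \ linkPrism s x)) := by
    refine hle.trans ?_
    calc _ ≤ ∑ u ∈ linkTriangle s x, 2 * #(misFamily (schurLink {s}) (U \ linkPrism s x)) := by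
          refine sum_le_sum fun u hu ↦ ?_
          have hu' : u ∈ linkPrism s x := mem_union_left _ hu
          rw [← linkPrism_eq_of_mem h3 hu']
          exact hbranch u (hCU x hx hu')
      _ ≤ 3 * (2 * #(misFamily (schurLink {s}) (U \ linkPrism s x))) := by
          rw [sum_const, smul_eq_mul]
          exact Nat.mul_le_mul_right _ card_le_three
      _ = _ := by ring
  have hss : U \ linkPrism s x ⊂ U :=
    Finset.ssubset_iff_subset_ne.2 ⟨sdiff_subset, fun h ↦ by
      have : x ∈ U \ linkPrism s x := h.symm ▸ hx
      exact (mem_sdiff.1 this).2 (mem_linkPrism.2 (.inl rfl))⟩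
  have hih := ih _ hss (fun y hy ↦ ?_) (fun y hy ↦ hne y (mem_sdiff.1 hy).1)
  · have hc : #(U \ linkPrism s x) + #(linkPrism s x) = #U := card_sdiff_add_card_eq_card (hCU x hx)
    have hc' : (#(U \ linkPrism s x) : ℝ) + 6 = #U := by rw [hCx] at hc; exact_mod_cast hc
    have h6 : (6 : ℝ) ≤ 2 ^ (0.435 * 6 : ℝ) := by
      have : (6 : ℝ) ^ 100 ≤ ((2 : ℝ) ^ (0.435 * 6 : ℝ)) ^ 100 := by
        rw [← Real.rpow_natCast ((2 : ℝ) ^ (0.435 * 6 : ℝ)), ← Real.rpow_mul (by norm_num),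
          show (0.435 * 6 * (100 : ℕ) : ℝ) = (261 : ℕ) by norm_num, Real.rpow_natCast,
          show 261 = 130 + 131 by norm_num, pow_add]
        norm_num
      exact le_of_pow_le_pow_left₀ (by norm_num) (by positivity) this
    calc (#(misFamily (schurLink {s}) U) : ℝ) ≤
          6 * #(misFamily (schurLink {s}) (U \ linkPrism s x)) := by exact_mod_cast hle'
      _ ≤ 2 ^ (0.435 * 6 : ℝ) * 2 ^ (0.435 * #(U \ linkPrism s x) : ℝ) := by gcongr
      _ = 2 ^ (0.435 * #U : ℝ) := by
        rw [← Real.rpow_add (by norm_num), ← hc']; congr 1; ring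
  · rw [mem_sdiff] at hy
    have key (z : G) (hz : z ∈ linkPrism s y) : z ∉ linkPrism s x := fun h ↦ by
      apply hy.2
      rw [← linkPrism_eq_of_mem h3 h, linkPrism_eq_of_mem h3 hz]
      exact mem_linkPrism.2 (.inl rfl)
    exact ⟨mem_sdiff.2 ⟨(hU y hy.1).1, key _ (mem_linkPrism.2 (by simp))⟩,
      mem_sdiff.2 ⟨(hU y hy.1).2, key _ (mem_linkPrism.2 (by simp))⟩⟩

end Prisms

section LinkBound

lemma two_rpow_branching {e q : ℝ} {k n : ℕ} (hq : 0 ≤ q) (hn : (n : ℝ) = e * 500)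
    (hqn : 1 ≤ q ^ 500 * 2 ^ n) (hqk : q + q ^ (k + 2) ≤ 1) :
    (2 : ℝ) ^ (-e) + 2 ^ (-((k + 2) * e)) ≤ 1 := by
  have h1 : (2 : ℝ) ^ (-e) ≤ q := by
    refine le_of_pow_le_pow_left₀ (n := 500) (by norm_num) hq ?_
    rw [← Real.rpow_natCast ((2 : ℝ) ^ (-e)), ← Real.rpow_mul (by norm_num), Nat.cast_ofNat,
      neg_mul, ← hn, Real.rpow_neg (by norm_num), Real.rpow_natCast, inv_le_iff_one_le_mul₀
      (by positivity)]
    exact hqn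
  have h2 : (2 : ℝ) ^ (-((k + 2) * e)) ≤ q ^ (k + 2) := by
    rw [mul_comm, ← neg_mul, Real.rpow_mul (by norm_num), ← Nat.cast_two, ← Nat.cast_add,
      Real.rpow_natCast]
    gcongr
    exact_mod_cast h1
  linarith

variable {G : Type} [AddCommGroup G]

lemma schurLink_singleton_triangleFree {s : G} (hs : s ≠ 0) (h3 : s + s ≠ -s) {x y z : G}
    (hx : x + x ≠ s + s + s) (hy : y + y ≠ s + s + s) (hz : z + z ≠ s + s + s)
    (hxy : (schurLink {s}).Adj x y) (hyz : (schurLink {s}).Adj y z) :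
    ¬ (schurLink {s}).Adj x z := by
  simp only [schurLink_adj, mem_singleton] at hxy hyz ⊢
  grind

lemma add_self_of_schurLink_adj {s v z : G} (h3 : s + s = -s)
    (hv : v + v = 0 ∨ v + v = s ∨ v + v = -s) (hvz : (schurLink {s}).Adj v z) :
    z + z = 0 ∨ z + z = s ∨ z + z = -s := by
  simp only [schurLink_adj, mem_singleton] at hvz
  have h3' : -s - s = s := by rw [sub_eq_add_neg, ← neg_add, h3, neg_neg]
  have hz : z + z = -s - (v + v) ∨ z + z = v + v + s ∨ z + z = v + v - s := by
    obtain h | h | h := hvz.2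
    · exact .inl (by rw [← h3, ← h]; abel)
    · refine .inr (.inl ?_)
      rw [show v + v + s = v + v - (s + s) by rw [h3, sub_neg_eq_add], ← h]; abel
    · refine .inr (.inr ?_)
      rw [sub_eq_add_neg, ← h3, ← h]; abel
  obtain h | h | h := hz <;> obtain h' | h' | h' := hv <;> rw [h, h'] <;>
    simp [h3, h3']

variable [Fintype G] {H : AddSubgroup G} {S U : Finset G}

lemma card_misFamily_schurLink_le_of_neg_mem (hU : U ⊆ oddCoset H)
    (hUS : ∀ x ∈ U, -x ∈ U ∧ x + x ∉ S) (hS : ∀ s ∈ S, -s ∈ S) (h0 : 0 ∉ S) :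
    (#(misFamily (schurLink S) U) : ℝ) ≤
      2 ^ (0.4935 * #(oddCoset H) + 3 * twoTorsionCard G : ℝ) := by
  classical
  obtain ⟨R, hRU, hR, hRc⟩ := exists_transversal (σ := Neg.neg) (U := U) neg_neg
    fun x hx ↦ (hUS x hx).1
  have h1 : #(misFamily (schurLink S) U) ≤ #(misFamily (schurLink S) R) := by
    refine card_misFamily_le_of_twins (σ := Neg.neg) hRU hR (fun x _ ↦ neg_neg x)
      (fun x hx ↦ (hUS x hx).1) fun x hx y hy hxy ↦ ?_
    rw [schurLink_adj] at hxy ⊢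
    have hxx := (hUS x hx).2
    refine ⟨fun h ↦ ?_, ?_⟩
    · subst h
      obtain h | h | h := hxy.2
      · rw [add_neg_cancel] at h; exact h0 h
      · rw [sub_neg_eq_add] at h; exact hxx h
      · have := hS _ h
        rw [neg_sub, sub_neg_eq_add] at this
        exact hxx this
    · obtain h | h | h := hxy.2
      · exact .inr (.inr (by rwa [sub_neg_eq_add, add_comm]))
      · exact .inl (by have := hS _ h; rwa [neg_sub, sub_eq_neg_add] at this)
      · exact .inl (by rwa [sub_eq_neg_add] at h)
  have h2 : #{x ∈ U | -x = x} ≤ twoTorsionCard G := by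
    refine card_le_card fun x hx ↦ ?_
    rw [mem_filter] at hx ⊢
    refine ⟨mem_univ _, ?_⟩
    nth_rewrite 1 [← hx.2]
    exact neg_add_cancel x
  have h3 : 2 * #R ≤ #(oddCoset H) + twoTorsionCard G :=
    hRc.trans (Nat.add_le_add (card_le_card hU) h2)
  have h3' : (2 * #R : ℝ) ≤ #(oddCoset H) + twoTorsionCard G := by exact_mod_cast h3
  have h4 : (#(misFamily (schurLink S) U) : ℝ) ≤ #(misFamily (schurLink S) R) := by
    exact_mod_cast h1
  refine h4.trans ((card_misFamily_le_two_rpow R).trans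
    (Real.rpow_le_rpow_of_exponent_le (by norm_num) ?_))
  have : (0 : ℝ) ≤ twoTorsionCard G := by positivity
  have : (0 : ℝ) ≤ #(oddCoset H) := by positivity
  linarith

lemma card_misFamily_schurLink_singleton_le_of_three {s : G} (hsH : s ∈ H) (hs : s ≠ 0)
    (h3 : s + s = -s) (hU : ∀ x, x ∈ U ↔ x ∉ H ∧ x + x ≠ s) :
    (#(misFamily (schurLink {s}) U) : ℝ) ≤
      2 ^ (0.4935 * #(oddCoset H) + 3 * twoTorsionCard G : ℝ) := by
  classical
  set D : Finset G := {x | x + x ∈ ({0, s, -s} : Finset G)} with hD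
  have hmem (x : G) : x ∈ D ↔ x + x = 0 ∨ x + x = s ∨ x + x = -s := by simp [hD]
  have hDc : #D ≤ 3 * twoTorsionCard G :=
    (le_of_eq_of_le (by simp only [D]) (card_filter_add_self_mem_le {0, s, -s})).trans
      (Nat.mul_le_mul_right _ card_le_three)
  have hO (W : Finset G) (hW : W \ D = oddCoset H \ D) :
      (#(misFamily (schurLink {s}) (W \ D)) : ℝ) ≤ 2 ^ (0.435 * #(oddCoset H) : ℝ) := by
    rw [hW]
    refine (card_misFamily_schurLink_le_of_three h3 hs (fun x hx ↦ ?_) fun x hx ↦ ?_).trans ?_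
    · rw [mem_sdiff, mem_oddCoset, hmem] at hx
      have e1 : -x + -x = -(x + x) := (neg_add _ _).symm
      have e2 : x + s + (x + s) = x + x - s := by rw [add_add_add_comm, h3, sub_eq_add_neg]
      simp only [mem_sdiff, mem_oddCoset, hmem, neg_mem_iff, H.add_mem_cancel_right hsH, e1, e2,
        neg_eq_iff_eq_neg, neg_zero, neg_neg, zero_add, sub_eq_iff_eq_add, h3,
        neg_add_cancel]
      tauto
    · rw [mem_sdiff, hmem] at hx
      tauto
    · gcongr
      · norm_num
      · exact sdiff_subset
  have key := card_misFamily_le_two_pow_mul (Γ := schurLink {s}) (D := D) (U := U)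
    (P := fun W ↦ W \ D = oddCoset H \ D) (K := 2 ^ (0.435 * #(oddCoset H) : ℝ)) ?_ ?_
    (by positivity) ?_
  · refine key.trans ?_
    rw [← Real.rpow_natCast, ← Real.rpow_add (by norm_num)]
    refine Real.rpow_le_rpow_of_exponent_le (by norm_num) ?_
    have : (#D : ℝ) ≤ 3 * twoTorsionCard G := by exact_mod_cast hDc
    have : (0 : ℝ) ≤ #(oddCoset H) := by positivity
    linarith
  · intro W hW v hv hvD
    refine ⟨?_, ?_⟩ <;> rw [← hW] <;> ext z
    · rw [mem_sdiff, mem_sdiff, mem_erase]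
      have : z ∉ D → z ≠ v := by rintro h rfl; exact h hvD
      tauto
    · rw [mem_sdiff, mem_sdiff, mem_outsideNbhd]
      have h1 : z ∉ D → z ≠ v := by rintro h rfl; exact h hvD
      have h2 : z ∉ D → ¬ (schurLink {s}).Adj v z := by
        rw [hmem] at hvD ⊢
        exact fun hz hvz ↦ hz (add_self_of_schurLink_adj h3 hvD hvz)
      tauto
  · intro W hW hWD
    have := hO W hW
    rwa [sdiff_eq_self_of_disjoint hWD] at this
  · ext x
    rw [mem_sdiff, mem_sdiff, mem_oddCoset, hU, hmem]
    tauto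

set_option exponentiation.threshold 600 in
lemma card_misFamily_schurLink_singleton_le_of_ne {s : G} (hsH : s ∈ H) (hs : s ≠ -s)
    (h3 : s + s ≠ -s) (hU : U ⊆ oddCoset H) :
    (#(misFamily (schurLink {s}) U) : ℝ) ≤
      2 ^ (0.4935 * #(oddCoset H) + 3 * twoTorsionCard G : ℝ) := by
  classical
  have hs0 : s ≠ 0 := by rintro rfl; simp at hs
  set D : Finset G := {x | x + x = s + s + s} with hD
  have hDc : #D ≤ twoTorsionCard G :=
    le_of_eq_of_le (by simp only [D]) (card_filter_add_self_eq_le (s + s + s))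
  have hm : (0 : ℝ) ≤ twoTorsionCard G := by positivity
  have key := card_misFamily_le_two_pow_mul (Γ := schurLink {s}) (D := D) (U := U)
    (P := fun W ↦ W ⊆ oddCoset H)
    (K := 2 ^ (0.493 * #(oddCoset H) + 0.108 * twoTorsionCard G : ℝ)) ?_ ?_
    (by positivity) hU
  · refine key.trans ?_
    rw [← Real.rpow_natCast, ← Real.rpow_add (by norm_num)]
    refine Real.rpow_le_rpow_of_exponent_le (by norm_num) ?_
    have : (#D : ℝ) ≤ twoTorsionCard G := by exact_mod_cast hDc
    have : (0 : ℝ) ≤ #(oddCoset H) := by positivity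
    linarith
  · intro W hW v _ _
    exact ⟨(erase_subset _ _).trans hW, (outsideNbhd_subset ..).trans hW⟩
  · intro W hW hWD
    have hWx (x : G) (hx : x ∈ W) : x + x ≠ s + s + s := fun h ↦
      disjoint_left.1 hWD hx (mem_filter.2 ⟨mem_univ _, h⟩)
    have hd : 3 = #(({s} : Finset G) ∪ ({s} : Finset G).image Neg.neg) + #({s} : Finset G) := by
      rw [image_singleton, card_singleton, ← insert_eq, card_pair hs]
    refine (card_misFamily_schurLink_le (H := H) (Subset.refl {s}) (by simpa using hsH)
      (by simpa using hs0.symm) (singleton_nonempty s) hd (k := 2) (a := 0.52) (b := 0.054)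
      (l := 1 / 2) (by norm_num)
      (two_rpow_branching (q := 0.724) (n := 233) (by norm_num) (by norm_num) ?_ (by norm_num))
      (by norm_num) (by norm_num) hW fun X hX ↦ ?_).trans
      (Real.rpow_le_rpow_of_exponent_le (by norm_num) ?_)
    · norm_num
    · exact card_misFamily_le_two_rpow_half X fun x hx y hy z hz ↦
        schurLink_singleton_triangleFree hs0 h3 (hWx x (hX hx)) (hWx y (hX hy)) (hWx z (hX hz))
    · rw [card_singleton]; push_cast; linarith

set_option exponentiation.threshold 600 in
lemma card_misFamily_schurLink_le_of_pair {s t : G} (hs : s ∈ S) (ht : t ∈ S) (hst : s ≠ t)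
    (hst' : t ≠ -s) (hss : s ≠ -s) (hsH : s ∈ H) (htH : t ∈ H) (h0 : 0 ∉ S) (hU : U ⊆ oddCoset H) :
    (#(misFamily (schurLink S) U) : ℝ) ≤
      2 ^ (0.4935 * #(oddCoset H) + 3 * twoTorsionCard G : ℝ) := by
  classical
  have hm : (0 : ℝ) ≤ twoTorsionCard G := by positivity
  have hSub : ({s, t} : Finset G) ⊆ S := by
    simp only [insert_subset_iff, singleton_subset_iff]; exact ⟨hs, ht⟩
  have hc2 : #({s, t} : Finset G) = 2 := card_pair hst
  have hc3 : 3 ≤ #(({s, t} : Finset G) ∪ ({s, t} : Finset G).image Neg.neg) := by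
    refine (card_eq_three.2 ⟨s, t, -s, hst, hss, hst', rfl⟩).ge.trans (card_le_card ?_)
    intro x
    simp only [mem_insert, mem_singleton, mem_union, mem_image]
    rintro (rfl | rfl | rfl) <;> simp
  have hc4 : #(({s, t} : Finset G) ∪ ({s, t} : Finset G).image Neg.neg) ≤ 4 := by
    refine (card_union_le _ _).trans ?_
    have := card_image_le (s := ({s, t} : Finset G)) (f := Neg.neg)
    omega
  generalize hd : #(({s, t} : Finset G) ∪ ({s, t} : Finset G).image Neg.neg) +
    #({s, t} : Finset G) = d
  have hd5 : (5 : ℝ) ≤ d := by exact_mod_cast (by omega : 5 ≤ d)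
  have hd6 : (d : ℝ) ≤ 6 := by exact_mod_cast (by omega : d ≤ 6)
  refine (card_misFamily_schurLink_le (H := H) hSub ?_ (fun h ↦ h0 (hSub h)) ⟨s, by simp⟩
      hd.symm (k := 3) (a := 0.581) (b := 0.175) (l := 0.5284) (by norm_num)
      (two_rpow_branching (q := 0.7548) (n := 203) (by norm_num) (by norm_num) ?_ (by norm_num))
      (by norm_num) ?_ hU fun X _ ↦ card_misFamily_le_two_rpow X).trans
      (Real.rpow_le_rpow_of_exponent_le (by norm_num) ?_)
  · simp [hsH, htH]
  · norm_num
  · have : (0.175 * (3 : ℕ) / (2 * d) : ℝ) ≤ 0.175 * (3 : ℕ) / (2 * 5) := by gcongr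
    norm_num at this ⊢
    linarith
  · rw [hc2]
    have : (d : ℝ) * twoTorsionCard G ≤ 6 * twoTorsionCard G := by gcongr
    push_cast
    linarith

/-- The number of maximal independent sets of the link graph of a sum-free subset of an index-two
subgroup. -/
lemma card_misFamily_schurLink_oddCoset_le (hS : IsSumFree (S : Set G))
    (hSH : ∀ s ∈ S, s ∈ H) (hU : ∀ x, x ∈ U ↔ x ∉ H ∧ x + x ∉ S) :
    (#(misFamily (schurLink S) U) : ℝ) ≤
      2 ^ (0.4935 * #(oddCoset H) + 3 * twoTorsionCard G : ℝ) := by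
  classical
  have h0 : (0 : G) ∉ S := fun h0 ↦ hS 0 h0 0 h0 (by simpa using h0)
  have hUO : U ⊆ oddCoset H := fun x hx ↦ mem_oddCoset.2 ((hU x).1 hx).1
  by_cases hsym : ∀ s ∈ S, -s ∈ S
  · refine card_misFamily_schurLink_le_of_neg_mem hUO (fun x hx ↦ ⟨?_, ((hU x).1 hx).2⟩) hsym h0
    rw [hU, neg_mem_iff] at *
    exact ⟨hx.1, fun h ↦ hx.2 (by simpa [add_comm] using hsym _ h)⟩
  push Not at hsym
  obtain ⟨s, hs, hs'⟩ := hsym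
  have hss : s ≠ -s := fun h ↦ hs' (h ▸ hs)
  by_cases hst : ∃ t ∈ S, t ≠ s
  · obtain ⟨t, ht, hts⟩ := hst
    exact card_misFamily_schurLink_le_of_pair hs ht hts.symm (fun h ↦ hs' (h ▸ ht)) hss (hSH s hs)
      (hSH t ht) h0 hUO
  push Not at hst
  obtain rfl : S = {s} := eq_singleton_iff_unique_mem.2 ⟨hs, hst⟩
  by_cases h3 : s + s = -s
  · exact card_misFamily_schurLink_singleton_le_of_three (hSH s hs) (fun h ↦ h0 (h ▸ hs)) h3
      (by simpa using hU)
  · exact card_misFamily_schurLink_singleton_le_of_ne (hSH s hs) hss h3 hUO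

end LinkBound

section Count

variable {G : Type} [AddCommGroup G] [Fintype G]

open scoped Classical in
lemma card_maxSumFree_filter_subset_le {C W : Finset G} (hW : IsSumFree (W : Set G)) {K : ℝ}
    (hK : ∀ S ⊆ C \ W, IsSumFree (S : Set G) →
      (#(misFamily (schurLink S) {x ∈ W | IsSumFree ((insert x S : Finset G) : Set G)}) : ℝ) ≤ K)
    (hK0 : 0 ≤ K) :
    (#{I ∈ maxSumFree G | I ⊆ C} : ℝ) ≤ 2 ^ #(C \ W) * K := by
  rw [card_eq_sum_card_fiberwise (f := (· \ W)) (t := (C \ W).powerset) fun I hI ↦ by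
    rw [mem_coe, mem_filter] at hI
    exact mem_coe.2 (mem_powerset.2 (sdiff_subset_sdiff hI.2 Subset.rfl))]
  have h2 : (2 : ℝ) ^ #(C \ W) = #(C \ W).powerset := by rw [card_powerset]; push_cast; rfl
  push_cast
  rw [h2, ← nsmul_eq_mul]
  refine sum_le_card_nsmul _ _ _ fun S hS ↦ ?_
  obtain h | ⟨I, hI⟩ := ({I ∈ {I ∈ maxSumFree G | I ⊆ C} | I \ W = S}).eq_empty_or_nonempty
  · rw [h]; simpa using hK0
  · simp only [mem_filter, mem_maxSumFree] at hI
    obtain ⟨⟨hI, -⟩, rfl⟩ := hI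
    refine le_trans ?_ (hK _ (mem_powerset.1 hS) (hI.1.mono (by simp)))
    refine le_trans ?_ (Nat.cast_le.2 (card_maxSumFree_filter_sdiff_le (S := I \ W) hW))
    gcongr
    exact filter_subset _ _

open scoped Classical in
lemma card_maxSumFree_filter_subset_le_two_rpow {C B : Finset G}
    (hB : IsSumFree (B : Set G)) (hCB : (#(C \ B) : ℝ) ≤ 0.0005 * Fintype.card G)
    (hm : (twoTorsionCard G : ℝ) ≤ 0.00001 * Fintype.card G) :
    (#{I ∈ maxSumFree G | I ⊆ C} : ℝ) ≤ 2 ^ (0.2489 * Fintype.card G : ℝ) := by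
  have hn : (0 : ℝ) ≤ Fintype.card G := by positivity
  obtain hcard | hcard := le_or_gt (100 * #B) (47 * Fintype.card G)
  · have hcard' : (100 * #B : ℝ) ≤ 47 * Fintype.card G := by exact_mod_cast hcard
    refine (card_maxSumFree_filter_subset_le hB
      (K := 2 ^ (0.5284 * #B : ℝ)) (fun S _ _ ↦ ?_) (by positivity)).trans ?_
    · refine (card_misFamily_le_two_rpow _).trans
        (Real.rpow_le_rpow_of_exponent_le (by norm_num) ?_)
      gcongr
      exact filter_subset _ _
    · rw [← Real.rpow_natCast, ← Real.rpow_add (by norm_num)]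
      exact Real.rpow_le_rpow_of_exponent_le (by norm_num) (by linarith)
  · obtain ⟨H, hH, hBH⟩ := exists_index_two_of_isSumFree hB hcard
    have hO : C \ oddCoset H ⊆ C \ B :=
      sdiff_subset_sdiff Subset.rfl fun x hx ↦ mem_oddCoset.2 (hBH x hx)
    have hO' : (#(C \ oddCoset H) : ℝ) ≤ #(C \ B) := by exact_mod_cast card_le_card hO
    have hN : (2 * #(oddCoset H) : ℝ) = Fintype.card G := by
      exact_mod_cast two_mul_card_oddCoset hH
    refine (card_maxSumFree_filter_subset_le (isSumFree_oddCoset hH)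
      (K := 2 ^ (0.4935 * #(oddCoset H) + 3 * twoTorsionCard G : ℝ)) (fun S hS hSf ↦ ?_)
      (by positivity)).trans ?_
    · have hSH (s : G) (hs : s ∈ S) : s ∈ H := by
        have := (mem_sdiff.1 (hS hs)).2
        rwa [mem_oddCoset, not_not] at this
      refine card_misFamily_schurLink_oddCoset_le hSf hSH fun x ↦ ?_
      rw [mem_filter, mem_oddCoset]
      exact and_congr_right fun hx ↦ isSumFree_insert_iff hH hSf hSH hx
    · rw [← Real.rpow_natCast, ← Real.rpow_add (by norm_num)]
      exact Real.rpow_le_rpow_of_exponent_le (by norm_num) (by linarith)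

omit [Fintype G] in
lemma exists_index_eq_two [Finite G] (h : Even (Nat.card G)) :
    ∃ H : AddSubgroup G, H.index = 2 := by
  have : Fact (Nat.Prime 2) := ⟨Nat.prime_two⟩
  obtain ⟨x, hx⟩ := exists_prime_addOrderOf_dvd_card' 2 h.two_dvd
  let φ : G →+ G := nsmulAddMonoidHom 2
  have hφ (y : G) : φ y = y + y := two_nsmul y
  have hinj : ¬ Function.Injective φ := by
    intro hinj
    have h2 : x + x = 0 := by rw [← two_nsmul, ← hx, addOrderOf_nsmul_eq_zero]
    have : x = 0 := hinj (by rw [hφ, h2, map_zero])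
    rw [this, addOrderOf_zero] at hx
    norm_num at hx
  have hsurj : ¬ Function.Surjective φ := fun h ↦ hinj (Finite.injective_iff_surjective.2 h)
  simp only [Function.Surjective, not_forall] at hsurj
  obtain ⟨a, ha⟩ := hsurj
  have hfin : {H : AddSubgroup G | φ.range ≤ H ∧ a ∉ H}.Finite := Set.toFinite _
  obtain ⟨H, ⟨hH, haH⟩, hmax⟩ := hfin.exists_maximal ⟨φ.range, le_rfl, ha⟩
  have h2H (y : G) : y + y ∈ H := hH ⟨y, hφ y⟩
  refine ⟨H, AddSubgroup.index_eq_two_iff_exists_notMem_and.2 ⟨a, haH, fun b ↦ ?_⟩⟩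
  by_contra! hcon
  let H' : AddSubgroup G :=
    { carrier := {x | x ∈ H ∨ x - b ∈ H}
      zero_mem' := .inl H.zero_mem
      add_mem' := by
        rintro x y (hx | hx) (hy | hy)
        · exact .inl (H.add_mem hx hy)
        · exact .inr (by rw [add_sub_assoc]; exact H.add_mem hx hy)
        · exact .inr (by rw [add_sub_right_comm]; exact H.add_mem hx hy)
        · refine .inl ?_
          have := H.add_mem (H.add_mem hx hy) (h2H b)
          rwa [show x - b + (y - b) + (b + b) = x + y by abel] at this
      neg_mem' := by
        rintro x (hx | hx)
        · exact .inl (H.neg_mem hx)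
        · refine .inr ?_
          have := H.sub_mem (H.neg_mem hx) (h2H b)
          rwa [show -(x - b) - (b + b) = -x - b by abel] at this }
  have hle : H ≤ H' := fun x hx ↦ .inl hx
  have hbH' : b ∈ H' := .inr (by rw [sub_self]; exact H.zero_mem)
  by_cases haH' : a ∈ H'
  · have haH'' : a - b ∈ H := haH'.resolve_left haH
    have := H.add_mem haH'' (h2H b)
    rw [show a - b + (b + b) = a + b by abel] at this
    exact hcon.1 (add_comm a b ▸ this)
  · exact hcon.2 (hmax ⟨hH.trans hle, haH'⟩ hle hbH')

lemma card_le_two_mul_sumFreeMu (h : Even (Fintype.card G)) :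
    Fintype.card G ≤ 2 * sumFreeMu G := by
  obtain ⟨H, hH⟩ := exists_index_eq_two (G := G) (by rwa [Nat.card_eq_fintype_card])
  rw [← two_mul_card_oddCoset hH]
  gcongr
  refine le_csSup ⟨Fintype.card G, ?_⟩ ⟨_, isSumFree_oddCoset hH, Set.ncard_coe_finset _⟩
  rintro k ⟨A, -, rfl⟩
  rw [← Nat.card_eq_fintype_card, ← Set.ncard_univ]
  exact Set.ncard_le_ncard (Set.subset_univ _)

lemma fMaxSF_eq_card : fMaxSF G = #(maxSumFree G) := by
  classical
  rw [fMaxSF, ← Set.ncard_coe_finset, ← Nat.card_coe_set_eq]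
  refine (Nat.card_congr ?_).symm
  exact Fintype.finsetEquivSet.subtypeEquiv fun I ↦ by simp [mem_maxSumFree]

lemma ncard_eq_twoTorsionCard : {x : G | x + x = 0}.ncard = twoTorsionCard G := by
  classical
  rw [twoTorsionCard, ← Set.ncard_coe_finset]
  simp

end Count

end MaximalSumFree

theorem few_maximal_sumfree_sets_in_even_groups_with_few_involutions :
    ∃ (c δ : ℝ), c ≥ 1 / 10 ^ 4 ∧ δ > 0 ∧ ∃ n₀ : ℕ,
      ∀ (G : Type) [AddCommGroup G] [Fintype G],
        Even (Fintype.card G) → Fintype.card G ≥ n₀ →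
        ({x : G | x + x = 0}.ncard : ℝ) ≤ δ * Fintype.card G →
        (fMaxSF G : ℝ) ≤ 2 ^ ((1 / 2 - c) * sumFreeMu G) := by
  obtain ⟨η, hη, hremoval⟩ := exists_isSumFree_subset (ε := 0.0005) (by norm_num)
  obtain ⟨n₀, hcont⟩ := exists_containers (ξ := 0.0005) hη (by norm_num)
  refine ⟨1 / 10 ^ 4, 0.00001, le_rfl, by norm_num, n₀, fun G _ _ heven hn hm ↦ ?_⟩
  classical
  rw [ncard_eq_twoTorsionCard] at hm
  obtain ⟨𝓕, h𝓕, hschur, hcover⟩ := hcont G hn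
  have hmu : (Fintype.card G : ℝ) ≤ 2 * sumFreeMu G := by
    exact_mod_cast card_le_two_mul_sumFreeMu heven
  have hsub : maxSumFree G ⊆ 𝓕.biUnion fun C ↦ {I ∈ maxSumFree G | I ⊆ C} := fun I hI ↦ by
    obtain ⟨C, hC, hIC⟩ := hcover I (mem_maxSumFree.1 hI).1
    exact Finset.mem_biUnion.2 ⟨C, hC, Finset.mem_filter.2 ⟨hI, hIC⟩⟩
  have hcard : ((maxSumFree G).card : ℝ) ≤ 𝓕.card * 2 ^ (0.2489 * Fintype.card G : ℝ) := by
    refine (Nat.cast_le.2 ((Finset.card_le_card hsub).trans Finset.card_biUnion_le)).trans ?_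
    rw [Nat.cast_sum, ← nsmul_eq_mul]
    refine Finset.sum_le_card_nsmul _ _ _ fun C hC ↦ ?_
    obtain ⟨B, -, hB, hCB⟩ := hremoval G C (hschur C hC)
    exact card_maxSumFree_filter_subset_le_two_rpow hB hCB hm
  rw [fMaxSF_eq_card]
  calc ((maxSumFree G).card : ℝ)
      ≤ 2 ^ (0.0005 * Fintype.card G : ℝ) * 2 ^ (0.2489 * Fintype.card G : ℝ) :=
        hcard.trans (by gcongr)
    _ = 2 ^ (0.2494 * Fintype.card G : ℝ) := by
        rw [← Real.rpow_add (by norm_num)]; congr 1; ring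
    _ ≤ _ := Real.rpow_le_rpow_of_exponent_le (by norm_num) (by linarith)
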